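/- arXiv:2011.11990 — 3 statements merged into one kernel-verified Lean document; each statement's English description precedes it below -/
import Mathlib

section
/- Hyperboloidal energy estimate. Let m ≥ 0 and let φ be a smooth function defined on a neighbourhood of K_{[s₀, s₁]}, vanishing near the conical boundary ∂K_{[s₀, s₁]}, and satisfying −□φ + m²φ = f there. Then for all s₀ ≤ s ≤ s₁: E_m(s, φ)^{1/2} ≤ E_m(s₀, φ)^{1/2} + ∫_{s₀}^{s} ‖f‖_{L²_f(H_τ)} dτ. -/
noncomputable section

open MeasureTheory

/-- A point of `ℝ^{1+2}`; coordinate `0` is the time `t`, coordinates `1, 2` are spatial. -/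
abbrev Pt : Type := Fin 3 → ℝ

/-- The spatial radius `r = |x| = √((x¹)² + (x²)²)`. -/
def rad (p : Pt) : ℝ := Real.sqrt ((p 1)^2 + (p 2)^2)

/-- The coordinate partial derivative `∂_i` (with `∂_0 = ∂_t`). -/
def pd (i : Fin 3) (φ : Pt → ℝ) (p : Pt) : ℝ := fderiv ℝ φ p (Pi.single i 1)

/-- `−□φ = ∂_t²φ − ∂_1²φ − ∂_2²φ`. -/
def negBox (φ : Pt → ℝ) (p : Pt) : ℝ :=
  pd 0 (pd 0 φ) p - pd 1 (pd 1 φ) p - pd 2 (pd 2 φ) p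

/-- The Lorentz boost `L_a = x^a ∂_t + t ∂_a`, for `a ∈ {1,2}` (indexed by `Fin 2`,
with `a : Fin 2` corresponding to the spatial coordinate `a.succ`). -/
def boost (a : Fin 2) (φ : Pt → ℝ) (p : Pt) : ℝ :=
  p a.succ * pd 0 φ p + p 0 * pd a.succ φ p

/-- The semi-hyperboloidal derivative `∂̲_a = (x^a/t) ∂_t + ∂_a`, `a ∈ {1,2}` (indexed by `Fin 2`). -/
def ubd (a : Fin 2) (φ : Pt → ℝ) (p : Pt) : ℝ :=
  (p a.succ / p 0) * pd 0 φ p + pd a.succ φ p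

/-- `∂̲_β` for `β ∈ {0,1,2}`, with `∂̲_0 = ∂_t`. -/
def ubar (β : Fin 3) (φ : Pt → ℝ) (p : Pt) : ℝ :=
  if β = 0 then pd 0 φ p else (p β / p 0) * pd 0 φ p + pd β φ p

/-- Iterated coordinate derivatives `∂^I`. -/
def pdSeq : List (Fin 3) → (Pt → ℝ) → Pt → ℝ
  | [], φ => φ
  | i :: I, φ => pd i (pdSeq I φ)

/-- Iterated boosts `L^J`. -/
def boostSeq : List (Fin 2) → (Pt → ℝ) → Pt → ℝ
  | [], φ => φ
  | a :: J, φ => boost a (boostSeq J φ)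

/-- The interior of the light cone, `K = {(t,x) : r < t − 1}`. -/
def coneK : Set Pt := {p | rad p < p 0 - 1}

/-- The slab `K_{[s0,s1]} = {(t,x) ∈ K : s0² ≤ t² − r² ≤ s1²}`. -/
def slab (s0 s1 : ℝ) : Set Pt :=
  {p | rad p < p 0 - 1 ∧ s0^2 ≤ (p 0)^2 - (rad p)^2 ∧ (p 0)^2 - (rad p)^2 ≤ s1^2}

/-- The parametrization `x ↦ (√(s² + |x|²), x)` of the hyperboloid `H_s`. -/
def hyp (s : ℝ) (x : Fin 2 → ℝ) : Pt :=
  ![Real.sqrt (s^2 + (x 0)^2 + (x 1)^2), x 0, x 1]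

/-- The flat `L²` norm on the hyperboloid `H_s`. -/
def L2f (s : ℝ) (g : Pt → ℝ) : ℝ :=
  Real.sqrt (∫ x : Fin 2 → ℝ, (g (hyp s x))^2)

/-- `φ` vanishes near the conical boundary `∂K_{[s0,s1]}` (i.e. on a neighbourhood of
`r = t − 1` within the slab, in particular outside the cone on the slab). -/
def VanishNearBdry (s0 s1 : ℝ) (φ : Pt → ℝ) : Prop :=
  ∃ ε > (0:ℝ), ∀ p : Pt, 0 < p 0 → s0^2 ≤ (p 0)^2 - (rad p)^2 →
    (p 0)^2 - (rad p)^2 ≤ s1^2 → p 0 - 1 - ε < rad p → φ p = 0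

/-- The hyperboloidal energy functional `E_m(s, φ)`. -/
def energyE (m s : ℝ) (φ : Pt → ℝ) : ℝ :=
  ∫ x : Fin 2 → ℝ,
    ((pd 0 φ (hyp s x))^2 + (pd 1 φ (hyp s x))^2 + (pd 2 φ (hyp s x))^2
      + 2 * (hyp s x 1 / hyp s x 0) * pd 0 φ (hyp s x) * pd 1 φ (hyp s x)
      + 2 * (hyp s x 2 / hyp s x 0) * pd 0 φ (hyp s x) * pd 2 φ (hyp s x)
      + m^2 * (φ (hyp s x))^2)

/-- The weighted inverted time translation `Kφ = (t + r²/t) ∂_t φ + 2 x^a ∂_a φ`. -/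
def Kvf (φ : Pt → ℝ) (p : Pt) : ℝ :=
  (p 0 + (rad p)^2 / p 0) * pd 0 φ p + 2 * (p 1 * pd 1 φ p + p 2 * pd 2 φ p)

/-- The conformal energy `E_con(s, φ)`. -/
def Econ (s : ℝ) (φ : Pt → ℝ) : ℝ :=
  ∫ x : Fin 2 → ℝ,
    ((s * ubd 0 φ (hyp s x))^2 + (s * ubd 1 φ (hyp s x))^2
      + (Kvf φ (hyp s x) + φ (hyp s x))^2)

namespace HypEst

lemma contDiff_pd (i : Fin 3) {g : Pt → ℝ} (hg : ContDiff ℝ (⊤ : ℕ∞) g) :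
    ContDiff ℝ (⊤ : ℕ∞) (pd i g) := by
  unfold pd
  exact (hg.fderiv_right (m := (⊤ : ℕ∞)) (by simp)).clm_apply contDiff_const

lemma pd_comm (i j : Fin 3) {g : Pt → ℝ} (hg : ContDiff ℝ (⊤ : ℕ∞) g) (p : Pt) :
    pd i (pd j g) p = pd j (pd i g) p := by
  have hd : DifferentiableAt ℝ (fderiv ℝ g) p :=
    ((hg.fderiv_right (m := (⊤ : ℕ∞)) (by simp)).differentiable (by simp)) p
  have key : ∀ k l : Fin 3, pd k (pd l g) p
      = fderiv ℝ (fderiv ℝ g) p (Pi.single k 1) (Pi.single l 1) := by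
    intro k l
    have h := (hd.hasFDerivAt.clm_apply (hasFDerivAt_const (Pi.single l (1:ℝ) : Pt) p)).fderiv
    unfold pd
    rw [h]; simp
  rw [key, key]
  have : IsSymmSndFDerivAt ℝ g p :=
    (hg.contDiffAt).isSymmSndFDerivAt (by
      rw [minSmoothness_of_isRCLikeNormedField]; 
      exact WithTop.coe_le_coe.2 (le_top : (2 : ℕ∞) ≤ ⊤))
  exact this _ _

lemma hyp_continuous : Continuous (fun q : ℝ × (Fin 2 → ℝ) => hyp q.1 q.2) := by
  unfold hyp
  refine continuous_pi (fun i => ?_)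
  fin_cases i <;> simp <;> fun_prop

lemma hyp_zero (s : ℝ) (x : Fin 2 → ℝ) :
    hyp s x 0 = Real.sqrt (s^2 + (x 0)^2 + (x 1)^2) := rfl
lemma hyp_one (s : ℝ) (x : Fin 2 → ℝ) : hyp s x 1 = x 0 := rfl
lemma hyp_two (s : ℝ) (x : Fin 2 → ℝ) : hyp s x 2 = x 1 := rfl

lemma hyp_pos {s : ℝ} (hs : 0 < s) (x : Fin 2 → ℝ) : 0 < hyp s x 0 := by
  rw [hyp_zero]; positivity

lemma hyp_sq (s : ℝ) (x : Fin 2 → ℝ) : (hyp s x 0)^2 = s^2 + (x 0)^2 + (x 1)^2 := by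
  rw [hyp_zero, Real.sq_sqrt (by positivity)]

/-- Chain rule along a curve given by components. -/
lemma chain {g : Pt → ℝ} (hg : ContDiff ℝ (⊤ : ℕ∞) g) {a b c : ℝ → ℝ} {a' b' c' t : ℝ}
    (ha : HasDerivAt a a' t) (hb : HasDerivAt b b' t) (hc : HasDerivAt c c' t) :
    HasDerivAt (fun τ => g ![a τ, b τ, c τ])
      (a' * pd 0 g ![a t, b t, c t] + b' * pd 1 g ![a t, b t, c t]
        + c' * pd 2 g ![a t, b t, c t]) t := by
  have hcv : HasDerivAt (fun τ => (![a τ, b τ, c τ] : Pt)) ![a', b', c'] t := by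
    rw [hasDerivAt_pi]
    intro i
    fin_cases i <;> simpa
  have h := ((hg.differentiable (by simp)) ![a t, b t, c t]).hasFDerivAt.comp_hasDerivAt t hcv
  refine h.congr_deriv ?_
  have : (![a', b', c'] : Pt) = a' • Pi.single 0 1 + b' • Pi.single 1 1 + c' • Pi.single 2 1 := by
    ext i; fin_cases i <;> simp [Pi.single_apply]
  rw [this]
  simp [pd]

lemma deriv_s {g : Pt → ℝ} (hg : ContDiff ℝ (⊤ : ℕ∞) g) {s : ℝ} (hs : 0 < s) (x : Fin 2 → ℝ) :
    HasDerivAt (fun τ => g (hyp τ x)) (s / hyp s x 0 * pd 0 g (hyp s x)) s := by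
  have hT : HasDerivAt (fun τ : ℝ => Real.sqrt (τ^2 + (x 0)^2 + (x 1)^2)) (s / hyp s x 0) s := by
    have h1 : HasDerivAt (fun τ : ℝ => τ^2 + (x 0)^2 + (x 1)^2) (2 * s) s := by
      simpa using (((hasDerivAt_id s).pow 2).add_const ((x 0)^2)).add_const ((x 1)^2)
    convert h1.sqrt (by positivity) using 1
    rw [hyp_zero]; field_simp
  have := chain hg hT (hasDerivAt_const s (x 0)) (hasDerivAt_const s (x 1))
  simpa [hyp] using this

lemma deriv_sT {s : ℝ} (hs : 0 < s) (x : Fin 2 → ℝ) :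
    HasDerivAt (fun τ => hyp τ x 0) (s / hyp s x 0) s := by
  have h := deriv_s (g := fun p : Pt => p 0) (by fun_prop) hs x
  convert h using 1
  simp [pd, fderiv_apply]

lemma line_T {s : ℝ} (hs : 0 < s) (x : Fin 2 → ℝ) (a : Fin 2) :
    HasDerivAt (fun τ : ℝ => hyp s (x + τ • Pi.single a 1) 0) (x a / hyp s x 0) 0 := by
  have h1 : HasDerivAt (fun τ : ℝ => s^2 + ((x + τ • (Pi.single a 1 : Fin 2 → ℝ)) 0)^2
      + ((x + τ • (Pi.single a 1 : Fin 2 → ℝ)) 1)^2) (2 * x a) 0 := by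
    fin_cases a
    · simpa using ((((hasDerivAt_id (0:ℝ)).const_add (x 0)).pow 2).const_add (s^2)).add_const
        ((x 1)^2)
    · simpa using ((((hasDerivAt_id (0:ℝ)).const_add (x 1)).pow 2).const_add (s^2 + (x 0)^2))
  have h2 := h1.sqrt (by positivity)
  refine h2.congr_deriv ?_
  rw [hyp_zero]; simp; field_simp

lemma line_0 {g : Pt → ℝ} (hg : ContDiff ℝ (⊤ : ℕ∞) g) {s : ℝ} (hs : 0 < s) (x : Fin 2 → ℝ) :
    HasDerivAt (fun τ : ℝ => g (hyp s (x + τ • Pi.single 0 1)))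
      (x 0 / hyp s x 0 * pd 0 g (hyp s x) + pd 1 g (hyp s x)) 0 := by
  have hT := line_T hs x 0
  have := chain hg hT ((hasDerivAt_id (0:ℝ)).const_add (x 0)) (hasDerivAt_const 0 (x 1))
  simpa [hyp] using this

lemma line_1 {g : Pt → ℝ} (hg : ContDiff ℝ (⊤ : ℕ∞) g) {s : ℝ} (hs : 0 < s) (x : Fin 2 → ℝ) :
    HasDerivAt (fun τ : ℝ => g (hyp s (x + τ • Pi.single 1 1)))
      (x 1 / hyp s x 0 * pd 0 g (hyp s x) + pd 2 g (hyp s x)) 0 := by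
  have hT := line_T hs x 1
  have := chain hg hT (hasDerivAt_const 0 (x 0)) ((hasDerivAt_id (0:ℝ)).const_add (x 1))
  simpa [hyp] using this

/-- Divergence theorem for compactly supported functions. -/
lemma integral_line_zero {W W' : (Fin 2 → ℝ) → ℝ} {v : Fin 2 → ℝ} {S : Set (Fin 2 → ℝ)}
    (hS : IsCompact S) (hW : Continuous W) (hW' : Continuous W')
    (h0 : ∀ x, x ∉ S → W x = 0) (h0' : ∀ x, x ∉ S → W' x = 0)
    (hd : ∀ x, HasDerivAt (fun τ : ℝ => W (x + τ • v)) (W' x) 0) :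
    ∫ x in S, W' x = 0 := by
  rw [setIntegral_eq_integral_of_forall_compl_eq_zero h0']
  have i1 : Integrable W := hW.integrable_of_hasCompactSupport (HasCompactSupport.intro hS h0)
  have i2 : Integrable W' := hW'.integrable_of_hasCompactSupport (HasCompactSupport.intro hS h0')
  have := integral_bilinear_hasLineDerivAt_right_eq_neg_left_of_integrable (μ := volume)
    (f := fun _ : Fin 2 → ℝ => (1:ℝ)) (f' := fun _ => 0) (g := W) (g' := W') (v := v)
    (B := ContinuousLinearMap.mul ℝ ℝ) (by simp) (by simpa using i2) (by simpa using i1)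
    (fun x _ => by simpa [HasLineDerivAt] using hasDerivAt_const (0:ℝ) (1:ℝ)) (fun x _ => hd x)
  simpa using this

lemma deriv_under {F F' : ℝ → (Fin 2 → ℝ) → ℝ} {S : Set (Fin 2 → ℝ)} (hS : IsCompact S)
    (hF : ContinuousOn (fun q : ℝ × (Fin 2 → ℝ) => F q.1 q.2) {q | 0 < q.1})
    (hF' : ContinuousOn (fun q : ℝ × (Fin 2 → ℝ) => F' q.1 q.2) {q | 0 < q.1})
    (hd : ∀ s x, 0 < s → HasDerivAt (fun τ => F τ x) (F' s x) s) {s : ℝ} (hs : 0 < s) :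
    HasDerivAt (fun τ => ∫ x in S, F τ x) (∫ x in S, F' s x) s := by
  have sl : ∀ (G : ℝ → (Fin 2 → ℝ) → ℝ),
      ContinuousOn (fun q : ℝ × (Fin 2 → ℝ) => G q.1 q.2) {q | 0 < q.1} →
      ∀ t, 0 < t → Continuous (G t) := by
    intro G hG t ht
    have := hG.comp_continuous (f := fun x : Fin 2 → ℝ => (t, x)) (by fun_prop) (fun x => ht)
    exact this
  obtain ⟨C, hC⟩ := (isCompact_Icc (a := s/2) (b := 2*s)).prod hS |>.exists_bound_of_continuousOn
    (hF'.mono (fun q hq => lt_of_lt_of_le (by positivity : 0 < s/2) hq.1.1))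
  have hn : Set.Icc (s/2) (2*s) ∈ nhds s := Icc_mem_nhds (by linarith) (by linarith)
  refine (hasDerivAt_integral_of_dominated_loc_of_deriv_le (bound := fun _ => C) hn ?_ ?_ ?_ ?_ ?_
    ?_).2
  · filter_upwards [hn] with t ht
    exact (sl F hF t (lt_of_lt_of_le (by positivity) ht.1)).aestronglyMeasurable
  · exact (sl F hF s hs).continuousOn.integrableOn_compact hS
  · exact (sl F' hF' s hs).aestronglyMeasurable
  · filter_upwards [ae_restrict_mem hS.measurableSet] with x hx t ht
    exact hC (t, x) ⟨ht, hx⟩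
  · exact continuous_const.continuousOn.integrableOn_compact hS
  · filter_upwards with x t ht
    exact hd t x (lt_of_lt_of_le (by positivity) ht.1)

lemma cauchy_schwarz {u v : (Fin 2 → ℝ) → ℝ} {S : Set (Fin 2 → ℝ)} (hS : IsCompact S)
    (hu : Continuous u) (hv : Continuous v) :
    ∫ x in S, u x * v x ≤ Real.sqrt (∫ x in S, (u x)^2) * Real.sqrt (∫ x in S, (v x)^2) := by
  have ii : ∀ w : (Fin 2 → ℝ) → ℝ, Continuous w → IntegrableOn w S :=
    fun w hw => hw.continuousOn.integrableOn_compact hS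
  have h := discrim_le_zero (a := ∫ x in S, (u x)^2) (b := 2 * ∫ x in S, u x * v x)
    (c := ∫ x in S, (v x)^2) (fun l => by
      have e : ∫ x in S, (l * u x + v x)^2 = (∫ x in S, (u x)^2) * (l * l)
          + 2 * (∫ x in S, u x * v x) * l + ∫ x in S, (v x)^2 := by
        have e1 : ∀ x, (l * u x + v x)^2 = l*l*(u x)^2 + (2*l) * (u x * v x) + (v x)^2 := by
          intro x; ring
        simp_rw [e1]
        rw [integral_add, integral_add, integral_const_mul, integral_const_mul]
        · ring
        all_goals exact ii _ (by fun_prop)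
      rw [← e]
      exact integral_nonneg (fun x => by positivity))
  rw [discrim] at h
  rw [← Real.sqrt_mul (integral_nonneg (fun x => by positivity))]
  refine (le_abs_self _).trans (Real.abs_le_sqrt (by nlinarith))

lemma vanish {s0 s1 : ℝ} (hs0 : 1 < s0) (hlt : s0 < s1) {g : Pt → ℝ} (hg : Continuous g) {ε : ℝ}
    (hε : 0 < ε)
    (hv : ∀ p : Pt, 0 < p 0 → s0^2 < (p 0)^2 - (rad p)^2 →
      (p 0)^2 - (rad p)^2 < s1^2 → p 0 - 1 - ε < rad p → g p = 0)
    {s : ℝ} (hs : s ∈ Set.Icc s0 s1) {x : Fin 2 → ℝ}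
    (hx : x ∉ Metric.closedBall (0 : Fin 2 → ℝ) (s1^2)) : g (hyp s x) = 0 := by
  have hopen : Set.EqOn (fun s => g (hyp s x)) (fun _ => 0) (Set.Ioo s0 s1) := by
    intro s hs
    have hr2 : (rad (hyp s x))^2 = (x 0)^2 + (x 1)^2 := by
      rw [rad, Real.sq_sqrt (by positivity)]; rfl
    have hr0 : 0 ≤ rad (hyp s x) := Real.sqrt_nonneg _
    have hr : s1^2 < rad (hyp s x) := by
      by_contra hcon
      push Not at hcon
      apply hx
      rw [mem_closedBall_zero_iff, pi_norm_le_iff_of_nonneg (by positivity)]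
      intro i
      rw [Real.norm_eq_abs]
      refine le_trans ?_ hcon
      apply abs_le_of_sq_le_sq _ hr0
      rw [hr2]
      fin_cases i <;> simp <;> positivity
    have hspos : 0 < s := by linarith [hs.1]
    have ht := hyp_sq s x
    have htp := hyp_pos hspos x
    apply hv _ htp
    · rw [ht, hr2]; nlinarith [hs.1]
    · rw [ht, hr2]; nlinarith [hs.2]
    · have : hyp s x 0 < 1 + rad (hyp s x) := by
        apply lt_of_pow_lt_pow_left₀ 2 (by positivity)
        nlinarith [hs.2]
      linarith
  have hcl := hopen.closure (by
    exact hg.comp (hyp_continuous.comp (by fun_prop : Continuous fun s : ℝ => (s, x))))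
    continuous_const
  rw [closure_Ioo hlt.ne] at hcl
  exact hcl hs

lemma pd_vanish {s0 s1 ε : ℝ} (i : Fin 3) {g : Pt → ℝ}
    (hv : ∀ p : Pt, 0 < p 0 → s0^2 < (p 0)^2 - (rad p)^2 →
      (p 0)^2 - (rad p)^2 < s1^2 → p 0 - 1 - ε < rad p → g p = 0) :
    ∀ p : Pt, 0 < p 0 → s0^2 < (p 0)^2 - (rad p)^2 →
      (p 0)^2 - (rad p)^2 < s1^2 → p 0 - 1 - ε < rad p → pd i g p = 0 := by
  intro p h1 h2 h3 h4
  have hrad : Continuous rad := by unfold rad; fun_prop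
  have : g =ᶠ[nhds p] fun _ => 0 := by
    have e1 : ∀ᶠ q : Pt in nhds p, 0 < q 0 :=
      (continuous_apply 0).continuousAt.eventually_const_lt h1
    have e2 : ∀ᶠ q : Pt in nhds p, s0^2 < (q 0)^2 - (rad q)^2 :=
      (by fun_prop : Continuous fun q : Pt => (q 0)^2 - (rad q)^2).continuousAt.eventually_const_lt
        h2
    have e3 : ∀ᶠ q : Pt in nhds p, (q 0)^2 - (rad q)^2 < s1^2 :=
      (by fun_prop : Continuous fun q : Pt => (q 0)^2 - (rad q)^2).continuousAt.eventually_lt_const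
        h3
    have e4 : ∀ᶠ q : Pt in nhds p, 0 < rad q - (q 0 - 1 - ε) :=
      (by fun_prop : Continuous fun q : Pt => rad q - (q 0 - 1 - ε)).continuousAt.eventually_const_lt
        (by linarith)
    filter_upwards [e1, e2, e3, e4] with q a b c d
    exact hv q a b c (by linarith)
  simp [pd, this.fderiv_eq]

/-- The energy density at a point. -/
def dens (m : ℝ) (φ : Pt → ℝ) (p : Pt) : ℝ :=
  (pd 0 φ p)^2 + (pd 1 φ p)^2 + (pd 2 φ p)^2
      + 2 * (p 1 / p 0) * pd 0 φ p * pd 1 φ p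
      + 2 * (p 2 / p 0) * pd 0 φ p * pd 2 φ p
      + m^2 * (φ p)^2

/-- Flux divergence in direction 1 on the hyperboloid. -/
def div1 (φ : Pt → ℝ) (s : ℝ) (p : Pt) : ℝ :=
  -(s * (p 1 / p 0)) / (p 0)^2 * (2 * pd 0 φ p * pd 1 φ p)
    + s / p 0 * (2 * (p 1 / p 0 * pd 0 (pd 0 φ) p + pd 1 (pd 0 φ) p) * pd 1 φ p
      + 2 * pd 0 φ p * (p 1 / p 0 * pd 0 (pd 1 φ) p + pd 1 (pd 1 φ) p))

/-- Flux divergence in direction 2 on the hyperboloid. -/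
def div2 (φ : Pt → ℝ) (s : ℝ) (p : Pt) : ℝ :=
  -(s * (p 2 / p 0)) / (p 0)^2 * (2 * pd 0 φ p * pd 2 φ p)
    + s / p 0 * (2 * (p 2 / p 0 * pd 0 (pd 0 φ) p + pd 2 (pd 0 φ) p) * pd 2 φ p
      + 2 * pd 0 φ p * (p 2 / p 0 * pd 0 (pd 2 φ) p + pd 2 (pd 2 φ) p))

/-- The source term. -/
def src (m : ℝ) (φ : Pt → ℝ) (p : Pt) : ℝ := negBox φ p + m^2 * φ p

lemma dens_deriv (m : ℝ) {φ : Pt → ℝ} (hφ : ContDiff ℝ (⊤ : ℕ∞) φ) {s : ℝ} (hs : 0 < s)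
    (x : Fin 2 → ℝ) :
    HasDerivAt (fun τ => dens m φ (hyp τ x))
      (2 * ((s / hyp s x 0 * pd 0 φ (hyp s x)) * src m φ (hyp s x))
        + div1 φ s (hyp s x) + div2 φ s (hyp s x)) s := by
  have h0 := deriv_s (contDiff_pd 0 hφ) hs x
  have h1 := deriv_s (contDiff_pd 1 hφ) hs x
  have h2 := deriv_s (contDiff_pd 2 hφ) hs x
  have h := deriv_s hφ hs x
  have hT := deriv_sT hs x
  have hp := hyp_pos hs x
  have q1 := ((hasDerivAt_const s (x 0)).div hT hp.ne').const_mul 2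
  have q2 := ((hasDerivAt_const s (x 1)).div hT hp.ne').const_mul 2
  have tot := (((((h0.pow 2).add (h1.pow 2)).add (h2.pow 2)).add ((q1.mul h0).mul h1)).add
    ((q2.mul h0).mul h2)).add ((h.pow 2).const_mul (m^2))
  refine tot.congr_deriv ?_
  simp only [src, negBox, div1, div2, hyp_one, hyp_two, pd_comm 1 0 hφ, pd_comm 2 0 hφ,
    Pi.mul_apply, Pi.div_apply]
  field_simp
  ring

lemma div1_line {φ : Pt → ℝ} (hφ : ContDiff ℝ (⊤ : ℕ∞) φ) {s : ℝ} (hs : 0 < s)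
    (x : Fin 2 → ℝ) :
    HasDerivAt (fun τ : ℝ => (fun y => s / hyp s y 0 * (2 * pd 0 φ (hyp s y) * pd 1 φ (hyp s y)))
      (x + τ • (Pi.single 0 1 : Fin 2 → ℝ))) (div1 φ s (hyp s x)) 0 := by
  have h0 := line_0 (contDiff_pd 0 hφ) hs x
  have h1 := line_0 (contDiff_pd 1 hφ) hs x
  have hT := line_T hs x 0
  have hp := hyp_pos hs x
  have tot := ((hasDerivAt_const (0:ℝ) s).div hT (by simpa using hp.ne')).mul
    ((h0.const_mul 2).mul h1)
  refine tot.congr_deriv ?_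
  simp [div1, hyp_one]

lemma div2_line {φ : Pt → ℝ} (hφ : ContDiff ℝ (⊤ : ℕ∞) φ) {s : ℝ} (hs : 0 < s)
    (x : Fin 2 → ℝ) :
    HasDerivAt (fun τ : ℝ => (fun y => s / hyp s y 0 * (2 * pd 0 φ (hyp s y) * pd 2 φ (hyp s y)))
      (x + τ • (Pi.single 1 1 : Fin 2 → ℝ))) (div2 φ s (hyp s x)) 0 := by
  have h0 := line_1 (contDiff_pd 0 hφ) hs x
  have h1 := line_1 (contDiff_pd 2 hφ) hs x
  have hT := line_T hs x 1
  have hp := hyp_pos hs x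
  have tot := ((hasDerivAt_const (0:ℝ) s).div hT (by simpa using hp.ne')).mul
    ((h0.const_mul 2).mul h1)
  refine tot.congr_deriv ?_
  simp [div2, hyp_two]

lemma dens_lower (m : ℝ) (φ : Pt → ℝ) {s : ℝ} (hs : 0 < s) (x : Fin 2 → ℝ) :
    (s / hyp s x 0 * pd 0 φ (hyp s x))^2 ≤ dens m φ (hyp s x) := by
  have hp := hyp_pos hs x
  have hq := hyp_sq s x
  have : dens m φ (hyp s x) = (s / hyp s x 0 * pd 0 φ (hyp s x))^2
      + (x 0 / hyp s x 0 * pd 0 φ (hyp s x) + pd 1 φ (hyp s x))^2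
      + (x 1 / hyp s x 0 * pd 0 φ (hyp s x) + pd 2 φ (hyp s x))^2 + (m * φ (hyp s x))^2 := by
    have hone : 1 = (s / hyp s x 0)^2 + (x 0 / hyp s x 0)^2 + (x 1 / hyp s x 0)^2 := by
      field_simp; linarith
    simp only [dens, hyp_one, hyp_two]
    linear_combination (pd 0 φ (hyp s x))^2 * hone
  rw [this]
  have := sq_nonneg (x 0 / hyp s x 0 * pd 0 φ (hyp s x) + pd 1 φ (hyp s x))
  have := sq_nonneg (x 1 / hyp s x 0 * pd 0 φ (hyp s x) + pd 2 φ (hyp s x))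
  have := sq_nonneg (m * φ (hyp s x))
  linarith

/-- The abstract Gronwall-type step. -/
lemma sqrt_step {E E' L : ℝ → ℝ} {s0 s : ℝ} (h : s0 ≤ s) (hE0 : ∀ t ∈ Set.Icc s0 s, 0 ≤ E t)
    (hE : ∀ t ∈ Set.Icc s0 s, HasDerivAt E (E' t) t) (hL : Continuous L) (hL0 : ∀ t, 0 ≤ L t)
    (hle : ∀ t ∈ Set.Icc s0 s, E' t ≤ 2 * (Real.sqrt (E t) * L t)) :
    Real.sqrt (E s) ≤ Real.sqrt (E s0) + ∫ τ in s0..s, L τ := by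
  have main : ∀ δ > (0:ℝ), Real.sqrt (E s + δ) ≤ Real.sqrt (E s0 + δ) + ∫ τ in s0..s, L τ := by
    intro δ hδ
    have hd : ∀ t ∈ Set.Icc s0 s, HasDerivAt
        (fun t => Real.sqrt (E t + δ) - ∫ τ in s0..t, L τ)
        (E' t / (2 * Real.sqrt (E t + δ)) - L t) t := by
      intro t ht
      have := hE0 t ht
      refine (((hE t ht).add_const δ).sqrt (by positivity)).sub ?_
      exact intervalIntegral.integral_hasDerivAt_right (hL.intervalIntegrable _ _)
        (hL.stronglyMeasurableAtFilter _ _) hL.continuousAt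
    have anti := antitoneOn_of_deriv_nonpos (convex_Icc s0 s)
      (fun t ht => (hd t ht).continuousAt.continuousWithinAt)
      (fun t ht => (hd t (interior_subset ht)).differentiableAt.differentiableWithinAt)
      (fun t ht => by
        have ht := interior_subset ht
        rw [(hd t ht).deriv]
        have := hE0 t ht
        have hp : 0 < Real.sqrt (E t + δ) := Real.sqrt_pos.2 (by positivity)
        have hm : Real.sqrt (E t) ≤ Real.sqrt (E t + δ) := Real.sqrt_le_sqrt (by linarith)
        rw [sub_nonpos, div_le_iff₀ (by positivity)]
        nlinarith [hle t ht, mul_le_mul_of_nonneg_right hm (hL0 t)])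
    have := anti (Set.left_mem_Icc.2 h) (Set.right_mem_Icc.2 h) h
    simp at this
    linarith
  have l1 : Filter.Tendsto (fun δ : ℝ => Real.sqrt (E s + δ)) (nhdsWithin 0 (Set.Ioi 0))
      (nhds (Real.sqrt (E s))) := by
    have : Continuous (fun δ : ℝ => Real.sqrt (E s + δ)) := by fun_prop
    simpa using (this.tendsto 0).mono_left nhdsWithin_le_nhds
  have l2 : Filter.Tendsto (fun δ : ℝ => Real.sqrt (E s0 + δ) + ∫ τ in s0..s, L τ)
      (nhdsWithin 0 (Set.Ioi 0)) (nhds (Real.sqrt (E s0) + ∫ τ in s0..s, L τ)) := by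
    have : Continuous (fun δ : ℝ => Real.sqrt (E s0 + δ) + ∫ τ in s0..s, L τ) := by fun_prop
    simpa using (this.tendsto 0).mono_left nhdsWithin_le_nhds
  refine le_of_tendsto_of_tendsto l1 l2 ?_
  filter_upwards [self_mem_nhdsWithin] with δ hδ using main δ hδ

end HypEst

open HypEst in
/-- **Hyperboloidal energy estimate** (Proposition 4.1).
If `−□φ + m²φ = f` in the slab `K_{[s₀,s₁]}` and `φ` vanishes near the conical boundary,
then `E_m(s,φ)^{1/2} ≤ E_m(s₀,φ)^{1/2} + ∫_{s₀}^s ‖f‖_{L²_f(H_τ)} dτ`. -/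
theorem hyperboloidal_energy_estimate
    (m : ℝ) (hm : 0 ≤ m) (s0 s1 : ℝ) (hs0 : 1 < s0) (hs01 : s0 ≤ s1)
    (φ : Pt → ℝ) (hφ : ContDiff ℝ (⊤ : ℕ∞) φ)
    (hvan : VanishNearBdry s0 s1 φ) :
    ∀ s : ℝ, s0 ≤ s → s ≤ s1 →
      Real.sqrt (energyE m s φ) ≤ Real.sqrt (energyE m s0 φ)
        + ∫ τ in s0..s, L2f τ (fun p => negBox φ p + m^2 * φ p) := by
  intro s hs hss
  rcases eq_or_lt_of_le hs with rfl | hlt0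
  · simp
  have hlt : s0 < s1 := lt_of_lt_of_le hlt0 hss
  obtain ⟨ε, hε, hvan⟩ := hvan
  have v : ∀ p : Pt, 0 < p 0 → s0^2 < (p 0)^2 - (rad p)^2 →
      (p 0)^2 - (rad p)^2 < s1^2 → p 0 - 1 - ε < rad p → φ p = 0 :=
    fun p a b c d => hvan p a b.le c.le d
  set S := Metric.closedBall (0 : Fin 2 → ℝ) (s1^2) with hSdef
  have hS : IsCompact S := isCompact_closedBall _ _
  have sm1 : ∀ i, ContDiff ℝ (⊤ : ℕ∞) (pd i φ) := fun i => contDiff_pd i hφ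
  have sm2 : ∀ i j, ContDiff ℝ (⊤ : ℕ∞) (pd i (pd j φ)) := fun i j => contDiff_pd i (sm1 j)
  have c0 := hφ.continuous
  have c1 := fun i => (sm1 i).continuous
  have c2 := fun i j => (sm2 i j).continuous
  have z0 : ∀ t ∈ Set.Icc s0 s1, ∀ x ∉ S, φ (hyp t x) = 0 :=
    fun t ht x hx => vanish hs0 hlt c0 hε v ht hx
  have z1 : ∀ i, ∀ t ∈ Set.Icc s0 s1, ∀ x ∉ S, pd i φ (hyp t x) = 0 :=
    fun i t ht x hx => vanish hs0 hlt (c1 i) hε (pd_vanish i v) ht hx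
  have z2 : ∀ i j, ∀ t ∈ Set.Icc s0 s1, ∀ x ∉ S, pd i (pd j φ) (hyp t x) = 0 :=
    fun i j t ht x hx => vanish hs0 hlt (c2 i j) hε (pd_vanish i (pd_vanish j v)) ht hx
  have csrc : Continuous (src m φ) := by
    have := c2 0 0
    have := c2 1 1
    have := c2 2 2
    unfold src negBox
    fun_prop
  have hh := hyp_continuous
  have hhs : ∀ t, Continuous (hyp t) := fun t =>
    hyp_continuous.comp (by fun_prop : Continuous fun x : Fin 2 → ℝ => (t, x))
  -- rewrite the quantities as integrals over the compact set
  have eE : ∀ t ∈ Set.Icc s0 s1, energyE m t φ = ∫ x in S, dens m φ (hyp t x) := by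
    intro t ht
    rw [setIntegral_eq_integral_of_forall_compl_eq_zero]
    · rfl
    · intro x hx
      simp [dens, z0 t ht x hx, z1 _ t ht x hx]
  have eL : ∀ t ∈ Set.Icc s0 s1, L2f t (fun p => negBox φ p + m^2 * φ p)
      = Real.sqrt (∫ x in S, (src m φ (hyp t x))^2) := by
    intro t ht
    rw [setIntegral_eq_integral_of_forall_compl_eq_zero]
    · rfl
    · intro x hx
      simp [src, negBox, z0 t ht x hx, z2 _ _ t ht x hx]
  have eI : ∫ τ in s0..s, L2f τ (fun p => negBox φ p + m^2 * φ p)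
      = ∫ τ in s0..s, Real.sqrt (∫ x in S, (src m φ (hyp τ x))^2) := by
    apply intervalIntegral.integral_congr
    intro t ht
    rw [Set.uIcc_of_le hs] at ht
    exact eL t ⟨ht.1, ht.2.trans hss⟩
  rw [eI, eE s ⟨hs, hss⟩, eE s0 ⟨le_rfl, hs01⟩]
  have hpos : ∀ q : ℝ × (Fin 2 → ℝ), q ∈ {q : ℝ × (Fin 2 → ℝ) | 0 < q.1} → hyp q.1 q.2 0 ≠ 0 :=
    fun q hq => (hyp_pos hq q.2).ne'
  have cc : ∀ g : Pt → ℝ, Continuous g →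
      ContinuousOn (fun q : ℝ × (Fin 2 → ℝ) => g (hyp q.1 q.2)) {q | 0 < q.1} :=
    fun g hg => (hg.comp hh).continuousOn
  have k0 := cc _ c0
  have k1 := fun i => cc _ (c1 i)
  have k2 := fun i j => cc _ (c2 i j)
  have ks := cc _ csrc
  have kp := fun i => cc (fun p => p i) (continuous_apply i)
  have kr : ∀ i, ContinuousOn (fun q : ℝ × (Fin 2 → ℝ) => hyp q.1 q.2 i / hyp q.1 q.2 0)
      {q | 0 < q.1} := fun i => (kp i).div (kp 0) hpos
  have kt : ContinuousOn (fun q : ℝ × (Fin 2 → ℝ) => q.1 / hyp q.1 q.2 0) {q | 0 < q.1} :=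
    continuous_fst.continuousOn.div (kp 0) hpos
  have kD : ContinuousOn (fun q : ℝ × (Fin 2 → ℝ) => dens m φ (hyp q.1 q.2)) {q | 0 < q.1} := by
    unfold dens
    have := kr 1
    have := kr 2
    have := k1 0
    have := k1 1
    have := k1 2
    fun_prop
  have kd1 : ContinuousOn (fun q : ℝ × (Fin 2 → ℝ) => div1 φ q.1 (hyp q.1 q.2)) {q | 0 < q.1} := by
    unfold div1
    have := kr 1
    have := k1 0
    have := k1 1
    have := k2 0 0
    have := k2 0 1
    have := k2 1 0
    have := k2 1 1
    have l1 : ContinuousOn (fun q : ℝ × (Fin 2 → ℝ) => -(q.1 * (hyp q.1 q.2 1 / hyp q.1 q.2 0))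
        / (hyp q.1 q.2 0)^2) {q | 0 < q.1} :=
      (by fun_prop : ContinuousOn _ _).div ((kp 0).pow 2) (fun q hq => pow_ne_zero 2 (hpos q hq))
    fun_prop
  have kd2 : ContinuousOn (fun q : ℝ × (Fin 2 → ℝ) => div2 φ q.1 (hyp q.1 q.2)) {q | 0 < q.1} := by
    unfold div2
    have := kr 2
    have := k1 0
    have := k1 2
    have := k2 0 0
    have := k2 0 2
    have := k2 2 0
    have := k2 2 2
    have l1 : ContinuousOn (fun q : ℝ × (Fin 2 → ℝ) => -(q.1 * (hyp q.1 q.2 2 / hyp q.1 q.2 0))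
        / (hyp q.1 q.2 0)^2) {q | 0 < q.1} :=
      (by fun_prop : ContinuousOn _ _).div ((kp 0).pow 2) (fun q hq => pow_ne_zero 2 (hpos q hq))
    fun_prop
  have ku : ContinuousOn (fun q : ℝ × (Fin 2 → ℝ) =>
      q.1 / hyp q.1 q.2 0 * pd 0 φ (hyp q.1 q.2)) {q | 0 < q.1} := kt.mul (k1 0)
  have kD' : ContinuousOn (fun q : ℝ × (Fin 2 → ℝ) =>
      2 * ((q.1 / hyp q.1 q.2 0 * pd 0 φ (hyp q.1 q.2)) * src m φ (hyp q.1 q.2))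
        + div1 φ q.1 (hyp q.1 q.2) + div2 φ q.1 (hyp q.1 q.2)) {q | 0 < q.1} := by
    fun_prop
  have sl : ∀ (G : ℝ → (Fin 2 → ℝ) → ℝ),
      ContinuousOn (fun q : ℝ × (Fin 2 → ℝ) => G q.1 q.2) {q | 0 < q.1} →
      ∀ t, 0 < t → Continuous (G t) := by
    intro G hG t ht
    exact hG.comp_continuous (f := fun x : Fin 2 → ℝ => (t, x)) (by fun_prop) (fun x => ht)
  have ii : ∀ w : (Fin 2 → ℝ) → ℝ, Continuous w → IntegrableOn w S :=
    fun w hw => hw.continuousOn.integrableOn_compact hS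
  refine sqrt_step (E := fun t => ∫ x in S, dens m φ (hyp t x))
    (L := fun t => Real.sqrt (∫ x in S, (src m φ (hyp t x))^2))
    (E' := fun t => ∫ x in S, (2 * ((t / hyp t x 0 * pd 0 φ (hyp t x)) * src m φ (hyp t x))
        + div1 φ t (hyp t x) + div2 φ t (hyp t x))) hs ?_ ?_ ?_ ?_ ?_
  · intro t ht
    have htp : 0 < t := by linarith [ht.1]
    exact integral_nonneg (fun x => (sq_nonneg _).trans (dens_lower m φ htp x))
  · intro t ht
    have htp : 0 < t := by linarith [ht.1]
    exact deriv_under (F := fun t x => dens m φ (hyp t x))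
      (F' := fun t x => 2 * ((t / hyp t x 0 * pd 0 φ (hyp t x)) * src m φ (hyp t x))
        + div1 φ t (hyp t x) + div2 φ t (hyp t x)) hS kD kD'
      (fun t x ht => dens_deriv m hφ ht x) htp
  · apply Real.continuous_sqrt.comp
    apply continuous_parametric_integral_of_continuous _ hS
    exact (csrc.comp hh).pow 2
  · intro t; exact Real.sqrt_nonneg _
  · intro t ht
    have htp : 0 < t := by linarith [ht.1]
    have ht' : t ∈ Set.Icc s0 s1 := ⟨ht.1, ht.2.trans hss⟩
    have hd1 := sl (fun t x => div1 φ t (hyp t x)) kd1 t htp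
    have hd2 := sl (fun t x => div2 φ t (hyp t x)) kd2 t htp
    have hu := sl (fun t x => t / hyp t x 0 * pd 0 φ (hyp t x)) ku t htp
    have htt := sl (fun t x => t / hyp t x 0) kt t htp
    have hf : Continuous (fun x => src m φ (hyp t x)) := csrc.comp (hhs t)
    have p1 : ∀ i, Continuous (fun x => pd i φ (hyp t x)) := fun i => (c1 i).comp (hhs t)
    have I1 : ∫ x in S, div1 φ t (hyp t x) = 0 :=
      integral_line_zero hS (htt.mul ((continuous_const.mul (p1 0)).mul (p1 1))) hd1
        (fun x hx => by simp [z1 _ t ht' x hx]) (fun x hx => by simp [div1, z1 _ t ht' x hx])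
        (div1_line hφ htp)
    have I2 : ∫ x in S, div2 φ t (hyp t x) = 0 :=
      integral_line_zero hS (htt.mul ((continuous_const.mul (p1 0)).mul (p1 2))) hd2
        (fun x hx => by simp [z1 _ t ht' x hx]) (fun x hx => by simp [div2, z1 _ t ht' x hx])
        (div2_line hφ htp)
    have huf : Continuous (fun x => 2 * ((t / hyp t x 0 * pd 0 φ (hyp t x)) * src m φ (hyp t x))) :=
      continuous_const.mul (hu.mul hf)
    show (∫ x in S, (2 * ((t / hyp t x 0 * pd 0 φ (hyp t x)) * src m φ (hyp t x))
        + div1 φ t (hyp t x) + div2 φ t (hyp t x))) ≤ _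
    have hsum : Continuous (fun x =>
        2 * ((t / hyp t x 0 * pd 0 φ (hyp t x)) * src m φ (hyp t x)) + div1 φ t (hyp t x)) :=
      huf.add hd1
    rw [integral_add (ii _ hsum) (ii _ hd2), integral_add (ii _ huf) (ii _ hd1), I1, I2,
      integral_const_mul, add_zero, add_zero]
    refine mul_le_mul_of_nonneg_left ((cauchy_schwarz hS hu hf).trans ?_) (by norm_num)
    refine mul_le_mul_of_nonneg_right (Real.sqrt_le_sqrt ?_) (Real.sqrt_nonneg _)
    exact integral_mono (ii _ (hu.pow 2)) (ii _ (sl (fun t x => dens m φ (hyp t x)) kD t htp))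
      (fun x => dens_lower m φ htp x)
end
end

section
/- Weighted (ghost-weight type) energy estimate. Let m ≥ 0, γ > 0, and let φ be a smooth function defined on a neighbourhood of K_{[s₀, s₁]}, vanishing near the conical boundary ∂K_{[s₀, s₁]}, and satisfying −□φ + m²φ = f there. Then for all s₀ ≤ s ≤ s₁: ∫_{H_s} (t − r)^{−γ} [ ((s/t) ∂_t φ)² + Σ_{a=1,2} (∂̲_a φ)² + m² φ² ] dx ≤ ∫_{H_{s₀}} (t − r)^{−γ} [ ((s₀/t) ∂_t φ)² + Σ_{a=1,2} (∂̲_a φ)² + m² φ² ] dx + 2 ∫_{s₀}^{s} ∫_{H_τ} (τ/t) (t − r)^{−γ} f ∂_t φ dx dτ, where all integrands over H_σ are evaluated at (√(σ² + |x|²), x) and integrated over x ∈ ℝ². -/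
noncomputable section

open MeasureTheory

/-- The `(t−r)`-weighted hyperboloidal energy. -/
def wEnergy (γ m s : ℝ) (φ : Pt → ℝ) : ℝ :=
  ∫ x : Fin 2 → ℝ,
    (hyp s x 0 - rad (hyp s x)) ^ (-γ) *
      (((s / hyp s x 0) * pd 0 φ (hyp s x))^2
        + (ubd 0 φ (hyp s x))^2 + (ubd 1 φ (hyp s x))^2
        + m^2 * (φ (hyp s x))^2)


/-! ### Helper lemmas -/

lemma gw_hyp0 (τ : ℝ) (x : Fin 2 → ℝ) : hyp τ x 0 = Real.sqrt (τ^2 + (x 0)^2 + (x 1)^2) := rfl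

lemma gw_hyp1 (τ : ℝ) (x : Fin 2 → ℝ) : hyp τ x 1 = x 0 := rfl

lemma gw_hyp2 (τ : ℝ) (x : Fin 2 → ℝ) : hyp τ x 2 = x 1 := rfl

lemma gw_rad (τ : ℝ) (x : Fin 2 → ℝ) : rad (hyp τ x) = Real.sqrt ((x 0)^2 + (x 1)^2) := rfl

lemma gw_T_pos {τ : ℝ} (hτ : 0 < τ) (x : Fin 2 → ℝ) : 0 < hyp τ x 0 := by
  rw [gw_hyp0]; positivity

lemma gw_T_sq (τ : ℝ) (x : Fin 2 → ℝ) : (hyp τ x 0)^2 = τ^2 + (x 0)^2 + (x 1)^2 := by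
  rw [gw_hyp0, Real.sq_sqrt (by positivity)]

lemma gw_Y_pos {τ : ℝ} (hτ : 0 < τ) (x : Fin 2 → ℝ) : 0 < hyp τ x 0 - rad (hyp τ x) := by
  rw [gw_hyp0, gw_rad, sub_pos]
  apply Real.sqrt_lt_sqrt (by positivity)
  nlinarith [sq_pos_of_pos hτ]

lemma gw_hyp_continuous : Continuous (fun z : ℝ × (Fin 2 → ℝ) => hyp z.1 z.2) := by
  unfold hyp
  refine continuous_pi fun i => ?_
  fin_cases i <;> simp <;> fun_prop

lemma gw_rad_continuous : Continuous rad := by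
  unfold rad; fun_prop

/-- smoothness of partial derivatives -/
lemma gw_pd_smooth {φ : Pt → ℝ} (hφ : ContDiff ℝ (⊤ : ℕ∞) φ) (i : Fin 3) :
    ContDiff ℝ (⊤ : ℕ∞) (pd i φ) := by
  unfold pd
  exact (hφ.fderiv_right (m := (⊤ : ℕ∞)) (by simp)).clm_apply contDiff_const

lemma gw_pd_symm {φ : Pt → ℝ} (hφ : ContDiff ℝ (⊤ : ℕ∞) φ) (i j : Fin 3) (p : Pt) :
    pd i (pd j φ) p = pd j (pd i φ) p := by
  have hs : IsSymmSndFDerivAt ℝ φ p :=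
    hφ.contDiffAt.isSymmSndFDerivAt (by
      simp only [minSmoothness_of_isRCLikeNormedField]; exact WithTop.coe_le_coe.2 (le_top : (2 : ℕ∞) ≤ ⊤))
  have hd : DifferentiableAt ℝ (fderiv ℝ φ) p :=
    ((hφ.fderiv_right (m := (⊤ : ℕ∞)) (by simp)).differentiable (by simp)) p
  have key : ∀ a b : Fin 3, pd a (pd b φ) p
      = fderiv ℝ (fderiv ℝ φ) p (Pi.single a 1) (Pi.single b 1) := by
    intro a b
    unfold pd
    rw [fderiv_clm_apply hd (differentiableAt_const _)]
    simp
  rw [key, key]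
  exact hs _ _

/-- chain rule along a curve -/
lemma gw_chain {G : Pt → ℝ} (hG : Differentiable ℝ G) {c : ℝ → Pt} {c' : Pt} {σ : ℝ}
    (hc : HasDerivAt c c' σ) :
    HasDerivAt (fun y => G (c y))
      (c' 0 * pd 0 G (c σ) + c' 1 * pd 1 G (c σ) + c' 2 * pd 2 G (c σ)) σ := by
  have h := (hG (c σ)).hasFDerivAt.comp_hasDerivAt σ hc
  refine h.congr_deriv ?_
  have : c' = c' 0 • Pi.single 0 1 + c' 1 • Pi.single 1 1 + c' 2 • Pi.single 2 1 := by
    ext i; fin_cases i <;> simp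
  conv_lhs => rw [this]
  simp only [map_add, map_smul, smul_eq_mul, pd]

lemma gw_curve_tau {τ : ℝ} (hτ : 0 < τ) (x : Fin 2 → ℝ) :
    HasDerivAt (fun y => hyp y x) ![τ / hyp τ x 0, 0, 0] τ := by
  rw [hasDerivAt_pi]
  intro i
  fin_cases i
  · have h : HasDerivAt (fun y : ℝ => y^2 + (x 0)^2 + (x 1)^2) (2 * τ) τ := by
      simpa using (((hasDerivAt_id τ).pow 2).add_const ((x 0)^2)).add_const ((x 1)^2)
    have h2 := h.sqrt (by positivity)
    refine h2.congr_deriv ?_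
    show _ = τ / hyp τ x 0
    rw [gw_hyp0]
    field_simp
  · simpa [hyp] using hasDerivAt_const τ (x 0)
  · simpa [hyp] using hasDerivAt_const τ (x 1)

lemma gw_curve_x0 {τ : ℝ} (hτ : 0 < τ) (x : Fin 2 → ℝ) :
    HasDerivAt (fun y => hyp τ (Function.update x 0 y)) ![x 0 / hyp τ x 0, 1, 0] (x 0) := by
  rw [hasDerivAt_pi]
  intro i
  fin_cases i
  · have h : HasDerivAt (fun y : ℝ => τ^2 + y^2 + (x 1)^2) (2 * x 0) (x 0) := by
      simpa using (((hasDerivAt_id (x 0)).pow 2).const_add (τ^2)).add_const ((x 1)^2)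
    have h2 := h.sqrt (by positivity)
    have h3 := h2.congr_deriv (g' := x 0 / hyp τ x 0) (by rw [gw_hyp0]; field_simp)
    simpa [hyp] using h3
  · have h3 := hasDerivAt_id' (x 0)
    simpa [hyp] using h3
  · simpa [hyp] using hasDerivAt_const (x 0) (x 1)

lemma gw_curve_x1 {τ : ℝ} (hτ : 0 < τ) (x : Fin 2 → ℝ) :
    HasDerivAt (fun y => hyp τ (Function.update x 1 y)) ![x 1 / hyp τ x 0, 0, 1] (x 1) := by
  rw [hasDerivAt_pi]
  intro i
  fin_cases i
  · have h : HasDerivAt (fun y : ℝ => τ^2 + (x 0)^2 + y^2) (2 * x 1) (x 1) := by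
      simpa using ((hasDerivAt_id (x 1)).pow 2).const_add (τ^2 + (x 0)^2)
    have h2 := h.sqrt (by positivity)
    have h3 := h2.congr_deriv (g' := x 1 / hyp τ x 0) (by rw [gw_hyp0]; field_simp)
    simpa [hyp] using h3
  · simpa [hyp] using hasDerivAt_const (x 1) (x 0)
  · have h3 := hasDerivAt_id' (x 1)
    simpa [hyp] using h3

lemma gw_T_le {τ : ℝ} (hτ : 0 < τ) {R : ℝ} (hR : τ^2 < R) (x : Fin 2 → ℝ) (hx : R ≤ ‖x‖) :
    hyp τ x 0 - 1 < rad (hyp τ x) := by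
  have hr : R ≤ rad (hyp τ x) := by
    rw [gw_rad]
    refine hx.trans ?_
    rw [pi_norm_le_iff_of_nonneg (by positivity)]
    intro i
    rw [Real.norm_eq_abs]
    apply Real.abs_le_sqrt
    fin_cases i <;> simp <;> positivity
  have hr2 : (rad (hyp τ x))^2 = (x 0)^2 + (x 1)^2 := by
    rw [gw_rad, Real.sq_sqrt (by positivity)]
  have hT := gw_T_sq τ x
  have hT0 := gw_T_pos hτ x
  have : 0 < τ^2 := by positivity
  nlinarith

/-- derivatives of functions vanishing on an open set vanish there -/
lemma gw_pd_vanish {Ω : Set Pt} (hΩ : IsOpen Ω) {G : Pt → ℝ} (hG : ∀ p ∈ Ω, G p = 0)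
    (i : Fin 3) : ∀ p ∈ Ω, pd i G p = 0 := by
  intro p hp
  have : G =ᶠ[nhds p] fun _ => 0 := by
    filter_upwards [hΩ.mem_nhds hp] with q hq using hG q hq
  unfold pd
  rw [this.fderiv_eq]; simp

/-- the open region where `φ` vanishes -/
def gwOmega (s0 s1 : ℝ) : Set Pt :=
  {p | 0 < p 0 ∧ s0^2 < (p 0)^2 - (rad p)^2 ∧ (p 0)^2 - (rad p)^2 < s1^2 ∧ p 0 - 1 < rad p}

lemma gw_Omega_open (s0 s1 : ℝ) : IsOpen (gwOmega s0 s1) := by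
  have := gw_rad_continuous
  unfold gwOmega
  simp only [Set.ofPred_and]
  refine IsOpen.inter ?_ (IsOpen.inter ?_ (IsOpen.inter ?_ ?_))
  · exact isOpen_lt (by fun_prop) (by fun_prop)
  · exact isOpen_lt (by fun_prop) (by fun_prop)
  · exact isOpen_lt (by fun_prop) (by fun_prop)
  · exact isOpen_lt (by fun_prop) (by fun_prop)

lemma gw_vanish_hyp {s0 s1 : ℝ} (h0 : 0 < s0) (h01 : s0 < s1) {G : Pt → ℝ} (hc : Continuous G)
    (hG : ∀ p ∈ gwOmega s0 s1, G p = 0) {τ : ℝ} (hτ : τ ∈ Set.Icc s0 s1) (x : Fin 2 → ℝ)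
    (hx : s1^2 + 1 ≤ ‖x‖) : G (hyp τ x) = 0 := by
  have hcl : IsClosed {y : ℝ | G (hyp y x) = 0} :=
    isClosed_eq (hc.comp (gw_hyp_continuous.comp (by fun_prop : Continuous fun y : ℝ => (y, x))))
      continuous_const
  have hsub : Set.Ioo s0 s1 ⊆ {y : ℝ | G (hyp y x) = 0} := by
    intro y hy
    have hy0 : 0 < y := h0.trans hy.1
    apply hG
    have hr2 : (rad (hyp y x))^2 = (x 0)^2 + (x 1)^2 := by
      rw [gw_rad, Real.sq_sqrt (by positivity)]
    have hT := gw_T_sq y x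
    refine ⟨gw_T_pos hy0 x, ?_, ?_, ?_⟩
    · nlinarith [hy.1]
    · nlinarith [hy.2]
    · exact gw_T_le hy0 (by nlinarith [hy.2]) x hx
  have := hcl.closure_subset_iff.2 hsub
  rw [closure_Ioo h01.ne] at this
  exact this hτ

/-- the weighted energy density -/
def gwE (γ m : ℝ) (φ : Pt → ℝ) (τ : ℝ) (x : Fin 2 → ℝ) : ℝ :=
  (hyp τ x 0 - rad (hyp τ x)) ^ (-γ) *
      (((τ / hyp τ x 0) * pd 0 φ (hyp τ x))^2
        + (ubd 0 φ (hyp τ x))^2 + (ubd 1 φ (hyp τ x))^2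
        + m^2 * (φ (hyp τ x))^2)

/-- the source term -/
def gwSrc (γ m : ℝ) (φ : Pt → ℝ) (τ : ℝ) (x : Fin 2 → ℝ) : ℝ :=
  (τ / hyp τ x 0) * (hyp τ x 0 - rad (hyp τ x)) ^ (-γ) *
    (negBox φ (hyp τ x) + m^2 * φ (hyp τ x)) * pd 0 φ (hyp τ x)

/-- expanded energy density, without the weight -/
def gwQ0 (m : ℝ) (φ : Pt → ℝ) (τ : ℝ) (x : Fin 2 → ℝ) : ℝ :=
  (pd 0 φ (hyp τ x))^2 + (pd 1 φ (hyp τ x))^2 + (pd 2 φ (hyp τ x))^2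
    + 2 * (x 0 * (hyp τ x 0)⁻¹) * (pd 0 φ (hyp τ x) * pd 1 φ (hyp τ x))
    + 2 * (x 1 * (hyp τ x 0)⁻¹) * (pd 0 φ (hyp τ x) * pd 2 φ (hyp τ x))
    + m^2 * (φ (hyp τ x))^2

lemma gwE_eq (γ m : ℝ) (φ : Pt → ℝ) {τ : ℝ} (hτ : 0 < τ) (x : Fin 2 → ℝ) :
    gwE γ m φ τ x = (hyp τ x 0 - rad (hyp τ x)) ^ (-γ) * gwQ0 m φ τ x := by
  have hT := gw_T_pos hτ x
  have hT2 := gw_T_sq τ x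
  have e0 : ubd 0 φ (hyp τ x) = x 0 / hyp τ x 0 * pd 0 φ (hyp τ x) + pd 1 φ (hyp τ x) := rfl
  have e1 : ubd 1 φ (hyp τ x) = x 1 / hyp τ x 0 * pd 0 φ (hyp τ x) + pd 2 φ (hyp τ x) := rfl
  unfold gwE gwQ0
  rw [e0, e1]
  congr 1
  have hτ2 : τ^2 = (hyp τ x 0)^2 - (x 0)^2 - (x 1)^2 := by linarith
  have : (τ / hyp τ x 0 * pd 0 φ (hyp τ x))^2
      = τ^2 * (pd 0 φ (hyp τ x) / hyp τ x 0)^2 := by ring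
  rw [this, hτ2]
  field_simp
  ring

/-- the `τ`-derivative of the energy density -/
def gwEdot (γ m : ℝ) (φ : Pt → ℝ) (τ : ℝ) (x : Fin 2 → ℝ) : ℝ :=
  (τ / hyp τ x 0) * (-γ * (hyp τ x 0 - rad (hyp τ x)) ^ (-γ - 1) * gwQ0 m φ τ x
    + (hyp τ x 0 - rad (hyp τ x)) ^ (-γ) *
      (2 * pd 0 φ (hyp τ x) * pd 0 (pd 0 φ) (hyp τ x)
        + 2 * pd 1 φ (hyp τ x) * pd 0 (pd 1 φ) (hyp τ x)
        + 2 * pd 2 φ (hyp τ x) * pd 0 (pd 2 φ) (hyp τ x)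
        + 2 * (x 0 * (hyp τ x 0)⁻¹) * (pd 0 (pd 0 φ) (hyp τ x) * pd 1 φ (hyp τ x)
            + pd 0 φ (hyp τ x) * pd 0 (pd 1 φ) (hyp τ x))
        + 2 * (x 1 * (hyp τ x 0)⁻¹) * (pd 0 (pd 0 φ) (hyp τ x) * pd 2 φ (hyp τ x)
            + pd 0 φ (hyp τ x) * pd 0 (pd 2 φ) (hyp τ x))
        + 2 * m^2 * (φ (hyp τ x) * pd 0 φ (hyp τ x))
        - 2 * (x 0 * ((hyp τ x 0)⁻¹)^2) * (pd 0 φ (hyp τ x) * pd 1 φ (hyp τ x))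
        - 2 * (x 1 * ((hyp τ x 0)⁻¹)^2) * (pd 0 φ (hyp τ x) * pd 2 φ (hyp τ x))))

lemma gwE_hasDerivAt (γ m : ℝ) {φ : Pt → ℝ} (hφ : ContDiff ℝ (⊤ : ℕ∞) φ) {τ : ℝ} (hτ : 0 < τ)
    (x : Fin 2 → ℝ) : HasDerivAt (fun y => gwE γ m φ y x) (gwEdot γ m φ τ x) τ := by
  have hT := gw_T_pos hτ x
  have hc := gw_curve_tau hτ x
  have hchain : ∀ G : Pt → ℝ, ContDiff ℝ (⊤ : ℕ∞) G →
      HasDerivAt (fun y => G (hyp y x)) (τ / hyp τ x 0 * pd 0 G (hyp τ x)) τ := by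
    intro G hG
    refine (gw_chain (hG.differentiable (by simp)) hc).congr_deriv ?_
    simp
  have hu := hchain φ hφ
  have h0 := hchain _ (gw_pd_smooth hφ 0)
  have h1 := hchain _ (gw_pd_smooth hφ 1)
  have h2 := hchain _ (gw_pd_smooth hφ 2)
  have hTd : HasDerivAt (fun y => hyp y x 0) (τ / hyp τ x 0) τ := by
    have := (hasDerivAt_pi.1 hc) 0
    simpa using this
  have hinv := hTd.inv hT.ne'
  have hY : HasDerivAt (fun y => hyp y x 0 - rad (hyp y x)) (τ / hyp τ x 0) τ := by
    simp only [gw_rad]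
    exact hTd.sub_const _
  have hW := hY.rpow_const (p := -γ) (Or.inl (gw_Y_pos hτ x).ne')
  have hQ : HasDerivAt (fun y => gwQ0 m φ y x) _ τ :=
    (((((h0.pow 2).add (h1.pow 2)).add (h2.pow 2)).add
      (((hinv.const_mul (x 0)).const_mul 2).mul (h0.mul h1))).add
      (((hinv.const_mul (x 1)).const_mul 2).mul (h0.mul h2))).add ((hu.pow 2).const_mul (m^2))
  have hall := hW.mul hQ
  have heq : (fun y => gwE γ m φ y x) =ᶠ[nhds τ]
      fun y => (hyp y x 0 - rad (hyp y x)) ^ (-γ) * gwQ0 m φ y x := by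
    filter_upwards [lt_mem_nhds hτ] with y hy using gwE_eq γ m φ hy x
  refine (hall.congr_of_eventuallyEq heq).congr_deriv ?_
  unfold gwEdot
  simp only [Pi.inv_apply, Pi.mul_apply]
  ring

/-- the flux -/
def gwV (γ : ℝ) (φ : Pt → ℝ) (τ : ℝ) (a : Fin 2) (x : Fin 2 → ℝ) : ℝ :=
  -2 * τ * (hyp τ x 0)⁻¹ * (hyp τ x 0 - rad (hyp τ x)) ^ (-γ) * (pd 0 φ (hyp τ x)) *
    (pd a.succ φ (hyp τ x))

/-- the favourable term -/
def gwGood (γ m : ℝ) (φ : Pt → ℝ) (τ : ℝ) (x : Fin 2 → ℝ) : ℝ :=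
  (τ / hyp τ x 0) * (γ * (hyp τ x 0 - rad (hyp τ x)) ^ (-γ - 1) *
    ((pd 0 φ (hyp τ x))^2 + (pd 1 φ (hyp τ x))^2 + (pd 2 φ (hyp τ x))^2 + m^2 * (φ (hyp τ x))^2
      + 2 * pd 0 φ (hyp τ x) * ((x 0 / rad (hyp τ x)) * pd 1 φ (hyp τ x)
        + (x 1 / rad (hyp τ x)) * pd 2 φ (hyp τ x))))

lemma gw_rad_pos {x : Fin 2 → ℝ} (hx : x ≠ 0) : 0 < (x 0)^2 + (x 1)^2 := by
  by_contra h
  apply hx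
  have h0 : x 0 = 0 := by nlinarith [sq_nonneg (x 0), sq_nonneg (x 1)]
  have h1 : x 1 = 0 := by nlinarith [sq_nonneg (x 0), sq_nonneg (x 1)]
  ext i; fin_cases i <;> simp [h0, h1]

lemma gwGood_nonneg {γ : ℝ} (hγ : 0 < γ) (m : ℝ) (φ : Pt → ℝ) {τ : ℝ} (hτ : 0 < τ)
    (x : Fin 2 → ℝ) : 0 ≤ gwGood γ m φ τ x := by
  have hT := gw_T_pos hτ x
  have hY := gw_Y_pos hτ x
  have hn : (x 0 / rad (hyp τ x))^2 + (x 1 / rad (hyp τ x))^2 ≤ 1 := by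
    rw [div_pow, div_pow, ← add_div, gw_rad, Real.sq_sqrt (by positivity)]
    exact div_self_le_one _
  unfold gwGood
  refine mul_nonneg (by positivity) (mul_nonneg (by positivity) ?_)
  generalize x 0 / rad (hyp τ x) = a at *
  generalize x 1 / rad (hyp τ x) = b at *
  generalize pd 0 φ (hyp τ x) = A
  generalize pd 1 φ (hyp τ x) = B
  generalize pd 2 φ (hyp τ x) = C
  nlinarith [sq_nonneg (a * A + B), sq_nonneg (b * A + C), sq_nonneg (m * φ (hyp τ x)),
    mul_nonneg (sub_nonneg.2 hn) (sq_nonneg A)]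

lemma gwV_differentiable (γ : ℝ) {φ : Pt → ℝ} (hφ : ContDiff ℝ (⊤ : ℕ∞) φ) {τ : ℝ} (hτ : 0 < τ)
    (a : Fin 2) {x : Fin 2 → ℝ} (hx : x ≠ 0) : DifferentiableAt ℝ (gwV γ φ τ a) x := by
  have hT := gw_T_pos hτ x
  have hY := gw_Y_pos hτ x
  have hr := gw_rad_pos hx
  have hTd : DifferentiableAt ℝ (fun y => hyp τ y 0) x := by
    simp only [gw_hyp0]
    refine DifferentiableAt.sqrt (by fun_prop) (by positivity)
  have hrd : DifferentiableAt ℝ (fun y => rad (hyp τ y)) x := by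
    simp only [gw_rad]
    refine DifferentiableAt.sqrt (by fun_prop) hr.ne'
  have hh : DifferentiableAt ℝ (fun y => hyp τ y) x := by
    rw [differentiableAt_pi]
    intro i
    fin_cases i
    · exact hTd
    · show DifferentiableAt ℝ (fun y : Fin 2 → ℝ => y 0) x
      fun_prop
    · show DifferentiableAt ℝ (fun y : Fin 2 → ℝ => y 1) x
      fun_prop
  have hG : ∀ i, DifferentiableAt ℝ (fun y => pd i φ (hyp τ y)) x := fun i =>
    (((gw_pd_smooth hφ i).differentiable (by simp)) (hyp τ x)).comp x hh
  unfold gwV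
  exact ((((hTd.inv hT.ne').const_mul _).mul
    ((hTd.sub hrd).rpow_const (Or.inl hY.ne'))).mul (hG 0)).mul (hG a.succ)

lemma gwV_deriv0 (γ : ℝ) {φ : Pt → ℝ} (hφ : ContDiff ℝ (⊤ : ℕ∞) φ) {τ : ℝ} (hτ : 0 < τ)
    {x : Fin 2 → ℝ} (hx : x ≠ 0) :
    fderiv ℝ (gwV γ φ τ 0) x (Pi.single 0 1) =
      -2 * τ * (-(x 0 * (hyp τ x 0)⁻¹ * ((hyp τ x 0)⁻¹)^2) * (hyp τ x 0 - rad (hyp τ x)) ^ (-γ)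
          * pd 0 φ (hyp τ x) * pd 1 φ (hyp τ x)
        + (hyp τ x 0)⁻¹ * (-γ * (x 0 * (hyp τ x 0)⁻¹ - x 0 / rad (hyp τ x))
          * (hyp τ x 0 - rad (hyp τ x)) ^ (-γ - 1)) * pd 0 φ (hyp τ x) * pd 1 φ (hyp τ x)
        + (hyp τ x 0)⁻¹ * (hyp τ x 0 - rad (hyp τ x)) ^ (-γ) *
          ((x 0 * (hyp τ x 0)⁻¹ * pd 0 (pd 0 φ) (hyp τ x) + pd 1 (pd 0 φ) (hyp τ x))
              * pd 1 φ (hyp τ x)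
            + pd 0 φ (hyp τ x) *
              (x 0 * (hyp τ x 0)⁻¹ * pd 0 (pd 1 φ) (hyp τ x) + pd 1 (pd 1 φ) (hyp τ x)))) := by
  have hT := gw_T_pos hτ x
  have hr := gw_rad_pos hx
  have hself : Function.update x 0 (x 0) = x := Function.update_eq_self 0 x
  have hc := gw_curve_x0 hτ x
  have hchain : ∀ G : Pt → ℝ, ContDiff ℝ (⊤ : ℕ∞) G →
      HasDerivAt (fun y => G (hyp τ (Function.update x 0 y)))
        (x 0 / hyp τ x 0 * pd 0 G (hyp τ x) + pd 1 G (hyp τ x)) (x 0) := by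
    intro G hG
    refine (gw_chain (hG.differentiable (by simp)) hc).congr_deriv ?_
    simp
  have h0 := hchain _ (gw_pd_smooth hφ 0)
  have h1 := hchain _ (gw_pd_smooth hφ 1)
  have hTd : HasDerivAt (fun y => hyp τ (Function.update x 0 y) 0) (x 0 / hyp τ x 0) (x 0) := by
    have := (hasDerivAt_pi.1 hc) 0
    simpa using this
  have hrd : HasDerivAt (fun y => rad (hyp τ (Function.update x 0 y)))
      (x 0 / rad (hyp τ x)) (x 0) := by
    have h : HasDerivAt (fun y : ℝ => y^2 + (x 1)^2) (2 * x 0) (x 0) := by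
      simpa using (((hasDerivAt_id (x 0)).pow 2)).add_const ((x 1)^2)
    have h2 := h.sqrt hr.ne'
    have h3 := h2.congr_deriv (g' := x 0 / rad (hyp τ x)) (by rw [gw_rad]; field_simp)
    simpa [gw_rad] using h3
  have hinv := hTd.inv (by rw [hself]; exact hT.ne')
  have hW := (hTd.sub hrd).rpow_const (p := -γ)
    (Or.inl (gw_Y_pos hτ (Function.update x 0 (x 0))).ne')
  have hall := (((hinv.const_mul (-2 * τ)).mul hW).mul h0).mul h1
  have hd := (gwV_differentiable γ hφ hτ 0 hx).hasFDerivAt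
  have hline : HasDerivAt (fun y => Function.update x 0 y) (Pi.single 0 1) (x 0) :=
    hasDerivAt_update x 0 (x 0)
  have hd2 := HasFDerivAt.comp_hasDerivAt (x 0) (by rw [hself]; exact hd) hline
  have huniq := hd2.unique hall
  rw [huniq]
  simp only [Pi.inv_apply, Pi.mul_apply, Pi.sub_apply, hself]
  ring

lemma gwV_deriv1 (γ : ℝ) {φ : Pt → ℝ} (hφ : ContDiff ℝ (⊤ : ℕ∞) φ) {τ : ℝ} (hτ : 0 < τ)
    {x : Fin 2 → ℝ} (hx : x ≠ 0) :
    fderiv ℝ (gwV γ φ τ 1) x (Pi.single 1 1) =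
      -2 * τ * (-(x 1 * (hyp τ x 0)⁻¹ * ((hyp τ x 0)⁻¹)^2) * (hyp τ x 0 - rad (hyp τ x)) ^ (-γ)
          * pd 0 φ (hyp τ x) * pd 2 φ (hyp τ x)
        + (hyp τ x 0)⁻¹ * (-γ * (x 1 * (hyp τ x 0)⁻¹ - x 1 / rad (hyp τ x))
          * (hyp τ x 0 - rad (hyp τ x)) ^ (-γ - 1)) * pd 0 φ (hyp τ x) * pd 2 φ (hyp τ x)
        + (hyp τ x 0)⁻¹ * (hyp τ x 0 - rad (hyp τ x)) ^ (-γ) *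
          ((x 1 * (hyp τ x 0)⁻¹ * pd 0 (pd 0 φ) (hyp τ x) + pd 2 (pd 0 φ) (hyp τ x))
              * pd 2 φ (hyp τ x)
            + pd 0 φ (hyp τ x) *
              (x 1 * (hyp τ x 0)⁻¹ * pd 0 (pd 2 φ) (hyp τ x) + pd 2 (pd 2 φ) (hyp τ x)))) := by
  have hT := gw_T_pos hτ x
  have hr := gw_rad_pos hx
  have hself : Function.update x 1 (x 1) = x := Function.update_eq_self 1 x
  have hc := gw_curve_x1 hτ x
  have hchain : ∀ G : Pt → ℝ, ContDiff ℝ (⊤ : ℕ∞) G →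
      HasDerivAt (fun y => G (hyp τ (Function.update x 1 y)))
        (x 1 / hyp τ x 0 * pd 0 G (hyp τ x) + pd 2 G (hyp τ x)) (x 1) := by
    intro G hG
    refine (gw_chain (hG.differentiable (by simp)) hc).congr_deriv ?_
    simp
  have h0 := hchain _ (gw_pd_smooth hφ 0)
  have h1 := hchain _ (gw_pd_smooth hφ 2)
  have hTd : HasDerivAt (fun y => hyp τ (Function.update x 1 y) 0) (x 1 / hyp τ x 0) (x 1) := by
    have := (hasDerivAt_pi.1 hc) 0
    simpa using this
  have hrd : HasDerivAt (fun y => rad (hyp τ (Function.update x 1 y)))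
      (x 1 / rad (hyp τ x)) (x 1) := by
    have h : HasDerivAt (fun y : ℝ => (x 0)^2 + y^2) (2 * x 1) (x 1) := by
      simpa using ((hasDerivAt_id (x 1)).pow 2).const_add ((x 0)^2)
    have h2 := h.sqrt hr.ne'
    have h3 := h2.congr_deriv (g' := x 1 / rad (hyp τ x)) (by rw [gw_rad]; field_simp)
    simpa [gw_rad] using h3
  have hinv := hTd.inv (by rw [hself]; exact hT.ne')
  have hW := (hTd.sub hrd).rpow_const (p := -γ)
    (Or.inl (gw_Y_pos hτ (Function.update x 1 (x 1))).ne')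
  have hall := (((hinv.const_mul (-2 * τ)).mul hW).mul h0).mul h1
  have hd := (gwV_differentiable γ hφ hτ 1 hx).hasFDerivAt
  have hline : HasDerivAt (fun y => Function.update x 1 y) (Pi.single 1 1) (x 1) :=
    hasDerivAt_update x 1 (x 1)
  have hd2 := HasFDerivAt.comp_hasDerivAt (x 1) (by rw [hself]; exact hd) hline
  have huniq := hd2.unique hall
  rw [huniq]
  simp only [Pi.inv_apply, Pi.mul_apply, Pi.sub_apply, hself]
  ring

lemma gw_identity (γ m : ℝ) {φ : Pt → ℝ} (hφ : ContDiff ℝ (⊤ : ℕ∞) φ) {τ : ℝ} (hτ : 0 < τ)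
    {x : Fin 2 → ℝ} (hx : x ≠ 0) :
    ∑ i : Fin 2, fderiv ℝ (gwV γ φ τ i) x (Pi.single i 1)
      = 2 * gwSrc γ m φ τ x - gwGood γ m φ τ x - gwEdot γ m φ τ x := by
  rw [Fin.sum_univ_two, gwV_deriv0 γ hφ hτ hx, gwV_deriv1 γ hφ hτ hx]
  unfold gwSrc gwGood gwEdot gwQ0 negBox
  rw [gw_pd_symm hφ 1 0, gw_pd_symm hφ 2 0]
  ring

lemma gw_cont_basic {φ : Pt → ℝ} (hφ : Continuous φ) :
    Continuous (fun z : ℝ × (Fin 2 → ℝ) => φ (hyp z.1 z.2)) := hφ.comp gw_hyp_continuous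

lemma gw_cont_Tinv : ContinuousOn (fun z : ℝ × (Fin 2 → ℝ) => (hyp z.1 z.2 0)⁻¹)
    {z | 0 < z.1} :=
  ContinuousOn.inv₀ (gw_cont_basic (continuous_apply 0)).continuousOn
    fun z hz => (gw_T_pos hz z.2).ne'

lemma gw_cont_W (a : ℝ) : ContinuousOn
    (fun z : ℝ × (Fin 2 → ℝ) => (hyp z.1 z.2 0 - rad (hyp z.1 z.2)) ^ a) {z | 0 < z.1} :=
  ContinuousOn.rpow_const
    ((gw_cont_basic (continuous_apply 0)).sub (gw_cont_basic gw_rad_continuous)).continuousOn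
    fun z hz => Or.inl (gw_Y_pos hz z.2).ne'

lemma gwQ0_cont (m : ℝ) {φ : Pt → ℝ} (hφ : ContDiff ℝ (⊤ : ℕ∞) φ) :
    ContinuousOn (fun z : ℝ × (Fin 2 → ℝ) => gwQ0 m φ z.1 z.2) {z | 0 < z.1} := by
  have hI := gw_cont_Tinv
  have hu := (gw_cont_basic hφ.continuous).continuousOn (s := {z | 0 < z.1})
  have h (i) := (gw_cont_basic (gw_pd_smooth hφ i).continuous).continuousOn (s := {z | 0 < z.1})
  have hx (i) : ContinuousOn (fun z : ℝ × (Fin 2 → ℝ) => z.2 i) {z | 0 < z.1} := by fun_prop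
  unfold gwQ0
  exact ((((((h 0).pow 2).add ((h 1).pow 2)).add ((h 2).pow 2)).add
    ((((hx 0).mul hI).const_mul 2).mul ((h 0).mul (h 1)))).add
    ((((hx 1).mul hI).const_mul 2).mul ((h 0).mul (h 2)))).add ((hu.pow 2).const_mul (m^2))

lemma gwE_cont (γ m : ℝ) {φ : Pt → ℝ} (hφ : ContDiff ℝ (⊤ : ℕ∞) φ) :
    ContinuousOn (fun z : ℝ × (Fin 2 → ℝ) => gwE γ m φ z.1 z.2) {z | 0 < z.1} :=
  ((gw_cont_W (-γ)).mul (gwQ0_cont m hφ)).congr fun z hz => gwE_eq γ m φ hz z.2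

lemma gw_cont_tauT : ContinuousOn (fun z : ℝ × (Fin 2 → ℝ) => z.1 / hyp z.1 z.2 0)
    {z | 0 < z.1} := continuous_fst.continuousOn.mul gw_cont_Tinv

lemma gwSrc_cont (γ m : ℝ) {φ : Pt → ℝ} (hφ : ContDiff ℝ (⊤ : ℕ∞) φ) :
    ContinuousOn (fun z : ℝ × (Fin 2 → ℝ) => gwSrc γ m φ z.1 z.2) {z | 0 < z.1} := by
  have hu := (gw_cont_basic hφ.continuous).continuousOn (s := {z | 0 < z.1})
  have h (i) := (gw_cont_basic (gw_pd_smooth hφ i).continuous).continuousOn (s := {z | 0 < z.1})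
  have hh (i) := (gw_cont_basic
    (gw_pd_smooth (gw_pd_smooth hφ i) i).continuous).continuousOn (s := {z | 0 < z.1})
  unfold gwSrc negBox
  exact ((gw_cont_tauT.mul (gw_cont_W (-γ))).mul
    ((((hh 0).sub (hh 1)).sub (hh 2)).add (hu.const_mul (m^2)))).mul (h 0)

lemma gwEdot_cont (γ m : ℝ) {φ : Pt → ℝ} (hφ : ContDiff ℝ (⊤ : ℕ∞) φ) :
    ContinuousOn (fun z : ℝ × (Fin 2 → ℝ) => gwEdot γ m φ z.1 z.2) {z | 0 < z.1} := by
  have hI := gw_cont_Tinv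
  have hu := (gw_cont_basic hφ.continuous).continuousOn (s := {z | 0 < z.1})
  have h (i) := (gw_cont_basic (gw_pd_smooth hφ i).continuous).continuousOn (s := {z | 0 < z.1})
  have hh (i) := (gw_cont_basic
    (gw_pd_smooth (gw_pd_smooth hφ i) 0).continuous).continuousOn (s := {z | 0 < z.1})
  have hx (i) : ContinuousOn (fun z : ℝ × (Fin 2 → ℝ) => z.2 i) {z | 0 < z.1} := by fun_prop
  unfold gwEdot
  refine gw_cont_tauT.mul ((((gw_cont_W (-γ - 1)).const_mul (-γ)).mul (gwQ0_cont m hφ)).add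
    ((gw_cont_W (-γ)).mul ?_))
  exact ((((((((((h 0).const_mul 2).mul (hh 0)).add (((h 1).const_mul 2).mul (hh 1))).add
    (((h 2).const_mul 2).mul (hh 2))).add
    ((((hx 0).mul hI).const_mul 2).mul (((hh 0).mul (h 1)).add ((h 0).mul (hh 1))))).add
    ((((hx 1).mul hI).const_mul 2).mul (((hh 0).mul (h 2)).add ((h 0).mul (hh 2))))).add
    ((hu.mul (h 0)).const_mul (2 * m^2))).sub
    ((((hx 0).mul (hI.pow 2)).const_mul 2).mul ((h 0).mul (h 1)))).sub
    ((((hx 1).mul (hI.pow 2)).const_mul 2).mul ((h 0).mul (h 2))))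

lemma gwV_cont (γ : ℝ) {φ : Pt → ℝ} (hφ : ContDiff ℝ (⊤ : ℕ∞) φ) (a : Fin 2) :
    ContinuousOn (fun z : ℝ × (Fin 2 → ℝ) => gwV γ φ z.1 a z.2) {z | 0 < z.1} := by
  have h (i) := (gw_cont_basic (gw_pd_smooth hφ i).continuous).continuousOn (s := {z | 0 < z.1})
  unfold gwV
  exact (((((continuous_const.mul continuous_fst).continuousOn).mul gw_cont_Tinv).mul
    (gw_cont_W (-γ))).mul (h 0)).mul (h a.succ)

lemma gw_slice_cont {F : ℝ → (Fin 2 → ℝ) → ℝ}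
    (hF : ContinuousOn (fun z : ℝ × (Fin 2 → ℝ) => F z.1 z.2) {z | 0 < z.1}) {τ : ℝ}
    (hτ : 0 < τ) : Continuous (F τ) := by
  have : ContinuousOn (fun x : Fin 2 → ℝ => F τ x) Set.univ :=
    hF.comp (f := fun x : Fin 2 → ℝ => (τ, x)) (by fun_prop) fun x _ => hτ
  exact continuousOn_univ.1 this

lemma gwGood_integrable (γ m : ℝ) {φ : Pt → ℝ} (hφ : ContDiff ℝ (⊤ : ℕ∞) φ) {τ : ℝ}
    (hτ : 0 < τ) {B : Set (Fin 2 → ℝ)} (hB : IsCompact B) :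
    IntegrableOn (gwGood γ m φ τ) B := by
  have h (i) := (gw_cont_basic (gw_pd_smooth hφ i).continuous).continuousOn (s := {z | 0 < z.1})
  have hu := (gw_cont_basic hφ.continuous).continuousOn (s := {z | 0 < z.1})
  have hpre := gw_cont_tauT.mul ((gw_cont_W (-γ - 1)).const_mul γ)
  have c0 := gw_slice_cont (F := fun τ x => (τ / hyp τ x 0 *
    (γ * (hyp τ x 0 - rad (hyp τ x)) ^ (-γ - 1))) * ((pd 0 φ (hyp τ x))^2
      + (pd 1 φ (hyp τ x))^2 + (pd 2 φ (hyp τ x))^2 + m^2 * (φ (hyp τ x))^2))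
      (hpre.mul (((((h 0).pow 2).add ((h 1).pow 2)).add ((h 2).pow 2)).add
        ((hu.pow 2).const_mul (m^2)))) hτ
  have c1 := gw_slice_cont (F := fun τ x => (τ / hyp τ x 0 *
    (γ * (hyp τ x 0 - rad (hyp τ x)) ^ (-γ - 1))) * (2 * (pd 0 φ (hyp τ x) * pd 1 φ (hyp τ x))))
      (hpre.mul (((h 0).mul (h 1)).const_mul 2)) hτ
  have c2 := gw_slice_cont (F := fun τ x => (τ / hyp τ x 0 *
    (γ * (hyp τ x 0 - rad (hyp τ x)) ^ (-γ - 1))) * (2 * (pd 0 φ (hyp τ x) * pd 2 φ (hyp τ x))))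
      (hpre.mul (((h 0).mul (h 2)).const_mul 2)) hτ
  have hn : ∀ (i : Fin 2) (x : Fin 2 → ℝ), ‖x i / rad (hyp τ x)‖ ≤ 1 := by
    intro i x
    rw [norm_div, gw_rad, Real.norm_eq_abs, Real.norm_eq_abs, abs_of_nonneg (Real.sqrt_nonneg _)]
    refine div_le_one_of_le₀ (Real.abs_le_sqrt ?_) (Real.sqrt_nonneg _)
    fin_cases i <;> simp <;> positivity
  have hm (i : Fin 2) : Measurable (fun x : Fin 2 → ℝ => x i / rad (hyp τ x)) := by
    simp only [gw_rad]
    fun_prop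
  have i0 := c0.continuousOn.integrableOn_compact (μ := volume) hB
  have i1 := (c1.continuousOn.integrableOn_compact (μ := volume) hB).bdd_mul (c := 1)
    (hm 0).aestronglyMeasurable (Filter.Eventually.of_forall (hn 0))
  have i2 := (c2.continuousOn.integrableOn_compact (μ := volume) hB).bdd_mul (c := 1)
    (hm 1).aestronglyMeasurable (Filter.Eventually.of_forall (hn 1))
  refine ((i0.add i1).add i2).congr (Filter.Eventually.of_forall fun x => ?_)
  simp only [Pi.add_apply]
  unfold gwGood
  ring

/-- the integral of the divergence vanishes; slice inequality -/
lemma gw_slice {γ : ℝ} (hγ : 0 < γ) (m : ℝ) {φ : Pt → ℝ} (hφ : ContDiff ℝ (⊤ : ℕ∞) φ) {τ : ℝ}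
    (hτ : 0 < τ) {R : ℝ} (hR : 0 < R)
    (hv : ∀ x : Fin 2 → ℝ, R ≤ ‖x‖ → pd 0 φ (hyp τ x) = 0) :
    ∫ x in Set.Icc (fun _ : Fin 2 => -R) (fun _ => R), gwEdot γ m φ τ x
      ≤ 2 * ∫ x in Set.Icc (fun _ : Fin 2 => -R) (fun _ => R), gwSrc γ m φ τ x := by
  set B : Set (Fin 2 → ℝ) := Set.Icc (fun _ : Fin 2 => -R) (fun _ => R) with hBdef
  have hB : IsCompact B := isCompact_Icc
  have iE : IntegrableOn (gwEdot γ m φ τ) B :=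
    (gw_slice_cont (gwEdot_cont γ m hφ) hτ).continuousOn.integrableOn_compact hB
  have iS : IntegrableOn (gwSrc γ m φ τ) B :=
    (gw_slice_cont (gwSrc_cont γ m hφ) hτ).continuousOn.integrableOn_compact hB
  have iG : IntegrableOn (gwGood γ m φ τ) B := gwGood_integrable γ m hφ hτ hB
  have hae : ∀ᵐ x ∂(volume.restrict B), 2 * gwSrc γ m φ τ x - gwGood γ m φ τ x - gwEdot γ m φ τ x
      = ∑ i : Fin 2, fderiv ℝ (gwV γ φ τ i) x (Pi.single i 1) := by
    apply ae_restrict_of_ae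
    have : ∀ᵐ x : Fin 2 → ℝ, x ≠ 0 := by
      rw [ae_iff]; simp
    filter_upwards [this] with x hx using (gw_identity γ m hφ hτ hx).symm
  have hdiv := integral_divergence_of_hasFDerivAt_off_countable'
    (fun _ : Fin 2 => -R) (fun _ => R) (fun _ => by simp only; linarith)
    (gwV γ φ τ) (fun i x => fderiv ℝ (gwV γ φ τ i) x) {0} (Set.countable_singleton 0)
    (fun i => (gw_slice_cont (F := fun τ x => gwV γ φ τ i x) (gwV_cont γ hφ i) hτ).continuousOn)
    (fun x hx i => (gwV_differentiable γ hφ hτ i (by simpa using hx.2)).hasFDerivAt)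
    ((((iS.const_mul 2).sub iG).sub iE).congr hae)
  have hz : ∀ (i : Fin 2) (x : Fin 2 → ℝ), R ≤ |x i| → gwV γ φ τ i x = 0 := by
    intro i x hx
    have := hv x (hx.trans (by simpa using norm_le_pi_norm x i))
    simp [gwV, this]
  have hz1 : ∀ (i : Fin 2) (y : Fin 1 → ℝ), gwV γ φ τ i (i.insertNth R y) = 0 :=
    fun i y => hz i _ (by simp [abs_of_pos hR])
  have hz2 : ∀ (i : Fin 2) (y : Fin 1 → ℝ), gwV γ φ τ i (i.insertNth (-R) y) = 0 :=
    fun i y => hz i _ (by simp [abs_of_pos hR])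
  simp only [hz1, hz2, integral_zero, sub_zero, Finset.sum_const_zero] at hdiv
  have iD : IntegrableOn (fun x => 2 * gwSrc γ m φ τ x - gwGood γ m φ τ x) B :=
    (iS.const_mul 2).sub iG
  rw [← integral_congr_ae hae, integral_sub iD iE,
    integral_sub (iS.const_mul 2) iG, integral_const_mul] at hdiv
  have : 0 ≤ ∫ x in B, gwGood γ m φ τ x :=
    integral_nonneg fun x => gwGood_nonneg hγ m φ hτ x
  linarith

lemma gw_restrict {F : (Fin 2 → ℝ) → ℝ} {R : ℝ} (hR : 0 < R) (hF : ∀ x, R ≤ ‖x‖ → F x = 0) :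
    ∫ x, F x = ∫ x in Set.Icc (fun _ : Fin 2 => -R) (fun _ => R), F x := by
  symm
  apply setIntegral_eq_integral_of_forall_compl_eq_zero
  intro x hx
  apply hF
  by_contra h
  apply hx
  push Not at h
  have : ∀ i, |x i| ≤ R := fun i => (by simpa using norm_le_pi_norm x i : |x i| ≤ ‖x‖).trans h.le
  exact ⟨fun i => (abs_le.1 (this i)).1, fun i => (abs_le.1 (this i)).2⟩

lemma gw_prod_integrable {F : ℝ → (Fin 2 → ℝ) → ℝ}
    (hF : ContinuousOn (fun z : ℝ × (Fin 2 → ℝ) => F z.1 z.2) {z | 0 < z.1}) {s0 s : ℝ}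
    (h0 : 0 < s0) (hs : s0 ≤ s) (B : Set (Fin 2 → ℝ)) (hB : IsCompact B) :
    Integrable (Function.uncurry F)
      ((volume.restrict (Set.uIoc s0 s)).prod (volume.restrict B)) := by
  rw [Measure.prod_restrict]
  have h1 : IntegrableOn (Function.uncurry F) (Set.Icc s0 s ×ˢ B) (volume.prod volume) :=
    (hF.mono fun z hz => h0.trans_le hz.1.1).integrableOn_compact (isCompact_Icc.prod hB)
  refine h1.mono_set (Set.prod_mono ?_ le_rfl)
  rw [Set.uIoc_of_le hs]
  exact Set.Ioc_subset_Icc_self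

/-- **Weighted (ghost-weight type) energy estimate** (Proposition 4.2).
If `−□φ + m²φ = f` in the slab and `φ` vanishes near the conical boundary, then for
`s₀ ≤ s ≤ s₁` the weighted energy on `H_s` is bounded by the one on `H_{s₀}` plus
`2∫_{s₀}^s ∫_{H_τ} (τ/t)(t−r)^{−γ} f ∂_tφ dx dτ`. -/
theorem ghost_weight_energy_estimate
    (m γ : ℝ) (hm : 0 ≤ m) (hγ : 0 < γ)
    (s0 s1 : ℝ) (hs0 : 1 < s0) (hs01 : s0 ≤ s1)
    (φ : Pt → ℝ) (hφ : ContDiff ℝ (⊤ : ℕ∞) φ)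
    (hvan : VanishNearBdry s0 s1 φ) :
    ∀ s : ℝ, s0 ≤ s → s ≤ s1 →
      wEnergy γ m s φ ≤ wEnergy γ m s0 φ
        + 2 * ∫ τ in s0..s, ∫ x : Fin 2 → ℝ,
            (τ / hyp τ x 0) * (hyp τ x 0 - rad (hyp τ x)) ^ (-γ) *
              (negBox φ (hyp τ x) + m^2 * φ (hyp τ x)) * pd 0 φ (hyp τ x) := by
  intro s hs hs'
  rcases eq_or_lt_of_le hs with rfl | hlt
  · simp
  have h0 : 0 < s0 := by linarith
  have h01 : s0 < s1 := hlt.trans_le hs'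
  obtain ⟨ε, hε, hvan⟩ := hvan
  have hΩ : ∀ p ∈ gwOmega s0 s1, φ p = 0 := fun p hp =>
    hvan p hp.1 hp.2.1.le hp.2.2.1.le (by linarith [hp.2.2.2])
  have hΩ1 : ∀ i, ∀ p ∈ gwOmega s0 s1, pd i φ p = 0 := fun i =>
    gw_pd_vanish (gw_Omega_open s0 s1) hΩ i
  have hR : 0 < s1^2 + 1 := by positivity
  have v0 : ∀ τ ∈ Set.Icc s0 s1, ∀ x : Fin 2 → ℝ, s1^2 + 1 ≤ ‖x‖ → φ (hyp τ x) = 0 :=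
    fun τ hτ x hx => gw_vanish_hyp h0 h01 hφ.continuous hΩ hτ x hx
  have v1 : ∀ i, ∀ τ ∈ Set.Icc s0 s1, ∀ x : Fin 2 → ℝ, s1^2 + 1 ≤ ‖x‖ →
      pd i φ (hyp τ x) = 0 :=
    fun i τ hτ x hx => gw_vanish_hyp h0 h01 (gw_pd_smooth hφ i).continuous (hΩ1 i) hτ x hx
  set B : Set (Fin 2 → ℝ) := Set.Icc (fun _ : Fin 2 => -(s1^2 + 1)) (fun _ => s1^2 + 1) with hBdef
  have hB : IsCompact B := isCompact_Icc
  have hE : ∀ τ ∈ Set.Icc s0 s1, wEnergy γ m τ φ = ∫ x in B, gwE γ m φ τ x := by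
    intro τ hτ
    refine gw_restrict (F := gwE γ m φ τ) hR fun x hx => ?_
    rw [gwE_eq γ m φ (h0.trans_le hτ.1)]
    simp [gwQ0, v0 τ hτ x hx, v1 _ τ hτ x hx]
  have hS : ∀ τ ∈ Set.Icc s0 s1, ∫ x : Fin 2 → ℝ,
      (τ / hyp τ x 0) * (hyp τ x 0 - rad (hyp τ x)) ^ (-γ) *
        (negBox φ (hyp τ x) + m^2 * φ (hyp τ x)) * pd 0 φ (hyp τ x)
      = ∫ x in B, gwSrc γ m φ τ x := by
    intro τ hτ
    refine gw_restrict (F := gwSrc γ m φ τ) hR fun x hx => ?_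
    simp [gwSrc, v1 _ τ hτ x hx]
  have hsub : Set.uIcc s0 s ⊆ Set.Icc s0 s1 := by
    rw [Set.uIcc_of_le hs]; exact Set.Icc_subset_Icc_right hs'
  rw [hE s ⟨hs, hs'⟩, hE s0 ⟨le_rfl, hs01⟩,
    intervalIntegral.integral_congr (g := fun τ => ∫ x in B, gwSrc γ m φ τ x)
      (fun τ hτ => hS τ (hsub hτ))]
  have iE : ∀ τ, 0 < τ → IntegrableOn (gwE γ m φ τ) B := fun τ hτ =>
    (gw_slice_cont (gwE_cont γ m hφ) hτ).continuousOn.integrableOn_compact hB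
  have hFTC : ∀ x : Fin 2 → ℝ, ∫ τ in s0..s, gwEdot γ m φ τ x
      = gwE γ m φ s x - gwE γ m φ s0 x := by
    intro x
    refine intervalIntegral.integral_eq_sub_of_hasDerivAt (f := fun τ => gwE γ m φ τ x)
      (fun τ hτ => gwE_hasDerivAt γ m hφ (h0.trans_le (hsub hτ).1) x) ?_
    apply ContinuousOn.intervalIntegrable
    exact (gwEdot_cont γ m hφ).comp (f := fun τ : ℝ => (τ, x)) (by fun_prop)
      fun τ hτ => h0.trans_le (hsub hτ).1
  have pE := gw_prod_integrable (gwEdot_cont γ m hφ) h0 hs B hB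
  have pS := gw_prod_integrable (gwSrc_cont γ m hφ) h0 hs B hB
  have hswap := intervalIntegral_integral_swap (f := fun τ x => gwEdot γ m φ τ x)
    (μ := volume.restrict B) (a := s0) (b := s) pE
  simp only [hFTC] at hswap
  rw [integral_sub (iE s (h0.trans hlt)) (iE s0 h0)] at hswap
  have jE : IntervalIntegrable (fun τ => ∫ x in B, gwEdot γ m φ τ x) volume s0 s := by
    rw [intervalIntegrable_iff]; exact pE.integral_prod_left
  have jS : IntervalIntegrable (fun τ => ∫ x in B, gwSrc γ m φ τ x) volume s0 s := by
    rw [intervalIntegrable_iff]; exact pS.integral_prod_left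
  have hmono := intervalIntegral.integral_mono_on hs jE (jS.const_mul 2) fun τ hτ =>
    gw_slice hγ m hφ (h0.trans_le hτ.1) hR (v1 0 τ ⟨hτ.1, hτ.2.trans hs'⟩)
  rw [intervalIntegral.integral_const_mul] at hmono
  linarith
end
end

section
/- Conformal energy estimate on hyperboloids. Let φ be a smooth function defined on a neighbourhood of K_{[s₀, s₁]}, vanishing near the conical boundary ∂K_{[s₀, s₁]}. Then for all s₀ ≤ s ≤ s₁: E_con(s, φ)^{1/2} ≤ E_con(s₀, φ)^{1/2} + 2 ∫_{s₀}^{s} τ ‖□φ‖_{L²_f(H_τ)} dτ. -/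
noncomputable section

open MeasureTheory

open scoped ContDiff Topology

section Calculus

theorem pd_smooth (i : Fin 3) {f : Pt → ℝ} (hf : ContDiff ℝ ∞ f) : ContDiff ℝ ∞ (pd i f) :=
  (hf.fderiv_right (m := ∞) (by simp)).clm_apply contDiff_const

theorem sm_diff {f : Pt → ℝ} (hf : ContDiff ℝ ∞ f) (p : Pt) : DifferentiableAt ℝ f p :=
  (hf.differentiable (by simp)).differentiableAt

theorem pd_add (i : Fin 3) {f g : Pt → ℝ} (hf : ContDiff ℝ ∞ f) (hg : ContDiff ℝ ∞ g) :
    pd i (fun p => f p + g p) = fun p => pd i f p + pd i g p := by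
  funext p
  unfold pd
  rw [fderiv_fun_add (sm_diff hf p) (sm_diff hg p)]
  rfl

theorem pd_sub (i : Fin 3) {f g : Pt → ℝ} (hf : ContDiff ℝ ∞ f) (hg : ContDiff ℝ ∞ g) :
    pd i (fun p => f p - g p) = fun p => pd i f p - pd i g p := by
  funext p
  unfold pd
  rw [fderiv_fun_sub (sm_diff hf p) (sm_diff hg p)]
  rfl

theorem pd_mul (i : Fin 3) {f g : Pt → ℝ} (hf : ContDiff ℝ ∞ f) (hg : ContDiff ℝ ∞ g) :
    pd i (fun p => f p * g p) = fun p => f p * pd i g p + pd i f p * g p := by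
  funext p
  unfold pd
  rw [fderiv_fun_mul (sm_diff hf p) (sm_diff hg p)]
  simp [mul_comm]

theorem pd_sq (i : Fin 3) {f : Pt → ℝ} (hf : ContDiff ℝ ∞ f) :
    pd i (fun p => f p ^ 2) = fun p => 2 * (f p * pd i f p) := by
  have : (fun p => f p ^ 2) = fun p => f p * f p := by funext p; ring
  rw [this, pd_mul i hf hf]
  funext p; ring

theorem pd_const (i : Fin 3) (c : ℝ) : pd i (fun _ => c) = fun _ => 0 := by
  funext p; simp [pd]

theorem coord_smooth (j : Fin 3) : ContDiff ℝ ∞ (fun p : Pt => p j) := contDiff_apply _ _ j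

theorem pd_coord (i j : Fin 3) : pd i (fun p : Pt => p j) = fun _ => if j = i then 1 else 0 := by
  funext p
  unfold pd
  have : HasFDerivAt (fun p : Pt => p j) (ContinuousLinearMap.proj (R := ℝ) (φ := fun _ : Fin 3 => ℝ) j) p :=
    hasFDerivAt_apply j p
  rw [this.fderiv]
  simp [Pi.single_apply]

theorem pd_comm (i j : Fin 3) {f : Pt → ℝ} (hf : ContDiff ℝ ∞ f) (p : Pt) :
    pd i (pd j f) p = pd j (pd i f) p := by
  have h : IsSymmSndFDerivAt ℝ f p := hf.contDiffAt.isSymmSndFDerivAt (by simpa using WithTop.coe_le_coe.2 (le_top : (2 : ℕ∞) ≤ ⊤))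
  have key : ∀ k l : Fin 3, pd k (pd l f) p
      = fderiv ℝ (fderiv ℝ f) p (Pi.single k 1) (Pi.single l 1) := by
    intro k l
    have hd : DifferentiableAt ℝ (fderiv ℝ f) p :=
      ((hf.fderiv_right (m := ∞) (by simp)).differentiable (by simp)).differentiableAt
    change fderiv ℝ (fun q => fderiv ℝ f q (Pi.single l 1)) p (Pi.single k 1) = _
    rw [fderiv_clm_apply hd (by fun_prop)]
    simp
  rw [key, key]
  exact h _ _

theorem pd_congr (i : Fin 3) {f g : Pt → ℝ} {p : Pt} (h : f =ᶠ[𝓝 p] g) : pd i f p = pd i g p := by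
  unfold pd; rw [h.fderiv_eq]

theorem pd_comp (i : Fin 3) {f : Pt → ℝ} {Q : Pt → Pt} (hf : ContDiff ℝ ∞ f) (hQ : ContDiff ℝ ∞ Q)
    (p : Pt) : pd i (fun q => f (Q q)) p
      = pd 0 f (Q p) * pd i (fun q => Q q 0) p + pd 1 f (Q p) * pd i (fun q => Q q 1) p
        + pd 2 f (Q p) * pd i (fun q => Q q 2) p := by
  have hQd : DifferentiableAt ℝ Q p := (hQ.differentiable (by simp)).differentiableAt
  have h1 : pd i (fun q => f (Q q)) p = fderiv ℝ f (Q p) (fderiv ℝ Q p (Pi.single i 1)) := by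
    unfold pd
    have := fderiv_comp p (sm_diff hf (Q p)) hQd
    change fderiv ℝ (f ∘ Q) p _ = _
    rw [this]; rfl
  have h2 : ∀ j, pd i (fun q => Q q j) p = fderiv ℝ Q p (Pi.single i 1) j := by
    intro j
    unfold pd
    have := (hasFDerivAt_pi'.1 hQd.hasFDerivAt) j
    rw [this.fderiv]; rfl
  rw [h1, h2, h2, h2]
  set w := fderiv ℝ Q p (Pi.single i 1)
  have hw : w = w 0 • Pi.single 0 1 + w 1 • Pi.single 1 1 + w 2 • Pi.single 2 1 := by
    funext j; fin_cases j <;> simp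
  conv_lhs => rw [hw]
  simp only [map_add, map_smul, smul_eq_mul, pd]
  ring

end Calculus

section Coords

/-- Globally positive smooth extension of `s² + |x|²`. -/
def HH (p : Pt) : ℝ := p 0 ^ 2 + (1 - Real.smoothTransition (p 0)) + p 1 ^ 2 + p 2 ^ 2

def TT (p : Pt) : ℝ := Real.sqrt (HH p)

def QQ (p : Pt) : Pt := ![TT p, p 1, p 2]

theorem HH_pos (p : Pt) : 0 < HH p := by
  unfold HH
  have h1 := Real.smoothTransition.le_one (p 0)
  rcases eq_or_ne (p 0) 0 with h | h
  · rw [h, Real.smoothTransition.zero_of_nonpos le_rfl]; positivity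
  · have : 0 < p 0 ^ 2 := by positivity
    nlinarith [sq_nonneg (p 1), sq_nonneg (p 2)]

theorem HH_smooth : ContDiff ℝ ∞ HH := by
  unfold HH
  have h : ContDiff ℝ ∞ (fun p : Pt => Real.smoothTransition (p 0)) :=
    Real.smoothTransition.contDiff.comp (coord_smooth 0)
  have h0 := coord_smooth 0
  have h1 := coord_smooth 1
  have h2 := coord_smooth 2
  exact (((h0.pow 2).add (contDiff_const.sub h)).add (h1.pow 2)).add (h2.pow 2)

theorem TT_pos (p : Pt) : 0 < TT p := Real.sqrt_pos.2 (HH_pos p)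

theorem TT_smooth : ContDiff ℝ ∞ TT := HH_smooth.sqrt (fun p => (HH_pos p).ne')

theorem QQ_smooth : ContDiff ℝ ∞ QQ := by
  rw [contDiff_pi]
  intro j
  fin_cases j
  · exact TT_smooth
  · exact coord_smooth 1
  · exact coord_smooth 2

theorem HH_eq {p : Pt} (hp : 1 ≤ p 0) : HH p = p 0 ^ 2 + p 1 ^ 2 + p 2 ^ 2 := by
  unfold HH; rw [Real.smoothTransition.one_of_one_le hp]; ring

theorem TT_sq {p : Pt} (hp : 1 ≤ p 0) : TT p ^ 2 = p 0 ^ 2 + p 1 ^ 2 + p 2 ^ 2 := by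
  unfold TT; rw [Real.sq_sqrt (HH_pos p).le, HH_eq hp]

theorem nhd_gt {p : Pt} (hp : 1 < p 0) : ∀ᶠ q : Pt in 𝓝 p, 1 < q 0 :=
  (isOpen_lt continuous_const (continuous_apply 0)).mem_nhds hp

theorem pd_TT (i : Fin 3) {p : Pt} (hp : 1 < p 0) : pd i TT p = p i / TT p := by
  have h1 : pd i (fun q => TT q ^ 2) p = pd i (fun q : Pt => q 0 ^ 2 + q 1 ^ 2 + q 2 ^ 2) p := by
    apply pd_congr
    filter_upwards [nhd_gt hp] with q hq using TT_sq hq.le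
  rw [pd_sq i TT_smooth, pd_add i (((coord_smooth 0).pow 2).add ((coord_smooth 1).pow 2))
    ((coord_smooth 2).pow 2), pd_add i ((coord_smooth 0).pow 2) ((coord_smooth 1).pow 2),
    pd_sq i (coord_smooth 0), pd_sq i (coord_smooth 1), pd_sq i (coord_smooth 2),
    pd_coord, pd_coord, pd_coord] at h1
  have hT := (TT_pos p).ne'
  rw [eq_div_iff hT]
  fin_cases i <;> simp at h1 ⊢ <;> linarith

/-- pullback of derivative in hyperbolic coordinates -/
theorem pd_pull (i : Fin 3) {f : Pt → ℝ} (hf : ContDiff ℝ ∞ f) {p : Pt} (hp : 1 < p 0) :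
    pd i (fun q => f (QQ q)) p = (p i / TT p) * pd 0 f (QQ p)
      + if i = 0 then 0 else pd i f (QQ p) := by
  rw [pd_comp i hf QQ_smooth]
  have e0 : (fun q => QQ q 0) = TT := rfl
  have e1 : (fun q => QQ q 1) = fun q => q 1 := rfl
  have e2 : (fun q => QQ q 2) = fun q => q 2 := rfl
  rw [e0, e1, e2, pd_TT i hp, pd_coord, pd_coord]
  fin_cases i <;> simp <;> ring

theorem pull_smooth {f : Pt → ℝ} (hf : ContDiff ℝ ∞ f) : ContDiff ℝ ∞ (fun q => f (QQ q)) :=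
  hf.comp QQ_smooth

/-- `v = s u_s + 2 x·∇u + u` -/
def vv (U : Pt → ℝ) (p : Pt) : ℝ :=
  p 0 * pd 0 U p + 2 * (p 1 * pd 1 U p + p 2 * pd 2 U p) + U p

def GG (U : Pt → ℝ) (p : Pt) : ℝ :=
  p 0 * pd 0 (pd 0 U) p + 2 * pd 0 U p + 2 * (p 1 * pd 1 (pd 0 U) p + p 2 * pd 2 (pd 0 U) p)
    - p 0 * (pd 1 (pd 1 U) p + pd 2 (pd 2 U) p)

def ee (U : Pt → ℝ) (p : Pt) : ℝ :=
  (p 0 * pd 1 U p) ^ 2 + (p 0 * pd 2 U p) ^ 2 + vv U p ^ 2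

def VV (i : Fin 3) (U : Pt → ℝ) (p : Pt) : ℝ :=
  2 * (p 0 * (pd i U p * vv U p)) - 2 * (p 0 * (p i * (pd 1 U p ^ 2 + pd 2 U p ^ 2)))

theorem pd2_pull (i j : Fin 3) {f : Pt → ℝ} (hf : ContDiff ℝ ∞ f) {p : Pt} (hp : 1 < p 0) :
    p j / TT p * pd i (fun q => f (QQ q)) p + TT p * pd j (pd i (fun q => f (QQ q))) p
     = (p i * pd j (fun q => pd 0 f (QQ q)) p + (if i = j then 1 else 0) * pd 0 f (QQ p))
      + if i = 0 then 0 else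
        (TT p * pd j (fun q => pd i f (QQ q)) p + p j / TT p * pd i f (QQ p)) := by
  have h1 : pd j (fun q => TT q * pd i (fun q => f (QQ q)) q) p
      = pd j (fun q => q i * (fun q => pd 0 f (QQ q)) q
        + (if i = 0 then 0 else TT q * (fun q => pd i f (QQ q)) q)) p := by
    apply pd_congr
    filter_upwards [nhd_gt hp] with q hq
    rw [pd_pull i hf hq]
    have := (TT_pos q).ne'
    split_ifs <;> field_simp <;> ring
  have hsi := pull_smooth (pd_smooth i hf)
  have hs0 := pull_smooth (pd_smooth 0 hf)
  rw [pd_mul j TT_smooth (pd_smooth i (pull_smooth hf))] at h1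
  beta_reduce at h1
  rw [pd_TT j hp] at h1
  by_cases hi : i = 0
  · simp only [hi, if_true, add_zero] at h1 ⊢
    rw [pd_mul j (coord_smooth 0) hs0, pd_coord] at h1
    beta_reduce at h1
    linarith
  · simp only [hi, if_false] at h1 ⊢
    rw [pd_add j ((coord_smooth i).mul hs0) (TT_smooth.mul hsi), pd_mul j (coord_smooth i) hs0,
      pd_mul j TT_smooth hsi, pd_coord] at h1
    beta_reduce at h1
    rw [pd_TT j hp] at h1
    linarith

theorem box_pull {f : Pt → ℝ} (hf : ContDiff ℝ ∞ f) {p : Pt} (hp : 1 < p 0) :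
    GG (fun q => f (QQ q)) p = p 0 * negBox f (QQ p) := by
  have a00 := pd2_pull 0 0 hf hp
  have a01 := pd2_pull 0 1 hf hp
  have a02 := pd2_pull 0 2 hf hp
  have a11 := pd2_pull 1 1 hf hp
  have a22 := pd2_pull 2 2 hf hp
  have hT := TT_sq hp.le
  have hT0 := TT_pos p
  have c1 := pd_comm 1 0 hf (QQ p)
  have c2 := pd_comm 2 0 hf (QQ p)
  rw [pd_pull 0 hf hp] at a00 a01 a02
  rw [pd_pull 1 hf hp] at a11
  rw [pd_pull 2 hf hp] at a22
  have s0 := pd_smooth 0 hf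
  have s1 := pd_smooth 1 hf
  have s2 := pd_smooth 2 hf
  rw [pd_pull 0 s0 hp] at a00
  rw [pd_pull 1 s0 hp] at a01
  rw [pd_pull 2 s0 hp] at a02
  rw [pd_pull 1 s0 hp, pd_pull 1 s1 hp] at a11
  rw [pd_pull 2 s0 hp, pd_pull 2 s2 hp] at a22
  unfold GG negBox
  rw [pd_pull 0 hf hp]
  simp only [if_true, one_ne_zero, if_false, Fin.isValue, zero_ne_one, add_zero, one_mul, zero_mul,
    show (2 : Fin 3) ≠ 0 by decide, show (0 : Fin 3) ≠ 2 by decide] at *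
  rw [← c1] at a11
  rw [← c2] at a22
  generalize pd 0 (pd 0 fun q => f (QQ q)) p = u00 at *
  generalize pd 1 (pd 0 fun q => f (QQ q)) p = u01 at *
  generalize pd 2 (pd 0 fun q => f (QQ q)) p = u02 at *
  generalize pd 1 (pd 1 fun q => f (QQ q)) p = u11 at *
  generalize pd 2 (pd 2 fun q => f (QQ q)) p = u22 at *
  generalize pd 0 (pd 0 f) (QQ p) = f00 at *
  generalize pd 1 (pd 0 f) (QQ p) = f01 at *
  generalize pd 2 (pd 0 f) (QQ p) = f02 at *
  generalize pd 1 (pd 1 f) (QQ p) = f11 at *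
  generalize pd 2 (pd 2 f) (QQ p) = f22 at *
  generalize pd 0 f (QQ p) = f0 at *
  generalize pd 1 f (QQ p) = f1 at *
  generalize pd 2 f (QQ p) = f2 at *
  generalize TT p = T at *
  generalize p 0 = s at *
  generalize p 1 = x at *
  generalize p 2 = y at *
  have hT0' := hT0.ne'
  have e00 : u00 = (s * (s / T * f00) + f0 - s / T * (s / T * f0)) / T := by
    rw [eq_div_iff hT0']; linarith
  have e01 : u01 = (s * (x / T * f00 + f01) - x / T * (s / T * f0)) / T := by
    rw [eq_div_iff hT0']; linarith
  have e02 : u02 = (s * (y / T * f00 + f02) - y / T * (s / T * f0)) / T := by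
    rw [eq_div_iff hT0']; linarith
  have e11 : u11 = (x * (x / T * f00 + f01) + f0 + (T * (x / T * f01 + f11) + x / T * f1)
      - x / T * (x / T * f0 + f1)) / T := by
    rw [eq_div_iff hT0']; linarith
  have e22 : u22 = (y * (y / T * f00 + f02) + f0 + (T * (y / T * f02 + f22) + y / T * f2)
      - y / T * (y / T * f0 + f2)) / T := by
    rw [eq_div_iff hT0']; linarith
  clear a00 a01 a02 a11 a22
  rw [e00, e01, e02, e11, e22]
  have hs : s ^ 2 = T ^ 2 - x ^ 2 - y ^ 2 := by linarith
  field_simp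
  simp only [hs]
  ring

end Coords
section Abstract

theorem cmul_smooth (c : ℝ) {f : Pt → ℝ} (hf : ContDiff ℝ ∞ f) :
    ContDiff ℝ ∞ (fun p => c * f p) := contDiff_const.mul hf

theorem pd_cmul (i : Fin 3) (c : ℝ) {f : Pt → ℝ} (hf : ContDiff ℝ ∞ f) :
    pd i (fun p => c * f p) = fun p => c * pd i f p := by
  rw [pd_mul i contDiff_const hf, pd_const]; simp

theorem vv_smooth {U : Pt → ℝ} (hU : ContDiff ℝ ∞ U) : ContDiff ℝ ∞ (vv U) := by
  have h0 := pd_smooth 0 hU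
  have h1 := pd_smooth 1 hU
  have h2 := pd_smooth 2 hU
  unfold vv
  fun_prop

theorem GG_smooth {U : Pt → ℝ} (hU : ContDiff ℝ ∞ U) : ContDiff ℝ ∞ (GG U) := by
  have h0 := pd_smooth 0 hU
  have h1 := pd_smooth 1 (pd_smooth 1 hU)
  have h2 := pd_smooth 2 (pd_smooth 2 hU)
  have h3 := pd_smooth 0 h0
  have h4 := pd_smooth 1 h0
  have h5 := pd_smooth 2 h0
  unfold GG
  fun_prop

theorem ee_smooth {U : Pt → ℝ} (hU : ContDiff ℝ ∞ U) : ContDiff ℝ ∞ (ee U) := by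
  have h0 := vv_smooth hU
  have h1 := pd_smooth 1 hU
  have h2 := pd_smooth 2 hU
  unfold ee
  fun_prop

theorem VV_smooth (i : Fin 3) {U : Pt → ℝ} (hU : ContDiff ℝ ∞ U) : ContDiff ℝ ∞ (VV i U) := by
  have h0 := vv_smooth hU
  have h1 := pd_smooth 1 hU
  have h2 := pd_smooth 2 hU
  have h3 := pd_smooth i hU
  unfold VV
  fun_prop

theorem pd_vv (i : Fin 3) {U : Pt → ℝ} (hU : ContDiff ℝ ∞ U) (p : Pt) : pd i (vv U) p =
    (p 0 * pd i (pd 0 U) p + (if 0 = i then 1 else 0) * pd 0 U p)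
    + 2 * ((p 1 * pd i (pd 1 U) p + (if 1 = i then 1 else 0) * pd 1 U p)
     + (p 2 * pd i (pd 2 U) p + (if 2 = i then 1 else 0) * pd 2 U p)) + pd i U p := by
  have h0 := pd_smooth 0 hU
  have h1 := pd_smooth 1 hU
  have h2 := pd_smooth 2 hU
  unfold vv
  simp (disch := fun_prop) only [pd_add, pd_cmul, pd_mul, pd_coord]

theorem pd_VV (i : Fin 3) {U : Pt → ℝ} (hU : ContDiff ℝ ∞ U) (hi : i ≠ 0) (p : Pt) :
    pd i (VV i U) p =
    2 * p 0 * (pd i (pd i U) p * vv U p + pd i U p * pd i (vv U) p)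
     - 2 * p 0 * (pd 1 U p ^ 2 + pd 2 U p ^ 2 + p i * (2 * pd 1 U p * pd i (pd 1 U) p +
       2 * pd 2 U p * pd i (pd 2 U) p)) := by
  have h0 := vv_smooth hU
  have h1 := pd_smooth 1 hU
  have h2 := pd_smooth 2 hU
  have h3 := pd_smooth i hU
  unfold VV
  simp (disch := fun_prop) only [pd_add, pd_sub, pd_cmul, pd_mul, pd_sq, pd_coord]
  simp [hi.symm]
  ring

theorem pd_ee {U : Pt → ℝ} (hU : ContDiff ℝ ∞ U) (p : Pt) :
    pd 0 (ee U) p = 2 * (GG U p * vv U p) + (pd 1 (VV 1 U) p + pd 2 (VV 2 U) p) := by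
  rw [pd_VV 1 hU (by decide), pd_VV 2 hU (by decide)]
  have h0 := vv_smooth hU
  have h1 := pd_smooth 1 hU
  have h2 := pd_smooth 2 hU
  unfold ee
  simp (disch := fun_prop) only [pd_add, pd_mul, pd_sq, pd_coord]
  rw [pd_vv 0 hU, pd_vv 1 hU, pd_vv 2 hU, pd_comm 0 1 hU, pd_comm 0 2 hU, pd_comm 1 2 hU]
  simp only [if_true, one_ne_zero, if_false, Fin.isValue, zero_ne_one, add_zero, one_mul, zero_mul,
    show (2 : Fin 3) ≠ 0 by decide, show (0 : Fin 3) ≠ 2 by decide,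
    show (2 : Fin 3) ≠ 1 by decide, show (1 : Fin 3) ≠ 2 by decide]
  unfold GG
  generalize vv U p = v
  ring

end Abstract
section Integrals

/-- The point `(s, x)`. -/
def mk (s : ℝ) (x : Fin 2 → ℝ) : Pt := ![s, x 0, x 1]

def KK (R : ℝ) : Set (Fin 2 → ℝ) := Metric.closedBall 0 R

/-- the region where things vanish -/
def WW (a b R : ℝ) : Set Pt := {p | (a < p 0 ∧ p 0 < b) ∧ (R < |p 1| ∨ R < |p 2|)}

theorem WW_open (a b R : ℝ) : IsOpen (WW a b R) := by
  unfold WW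
  exact ((isOpen_lt continuous_const (continuous_apply 0)).inter
    (isOpen_lt (continuous_apply 0) continuous_const)).inter
    ((isOpen_lt continuous_const (continuous_apply 1).abs).union
      (isOpen_lt continuous_const (continuous_apply 2).abs))

/-- `f` vanishes on `WW`. -/
def Van (a b R : ℝ) (f : Pt → ℝ) : Prop := ∀ p ∈ WW a b R, f p = 0

theorem Van.pd {a b R : ℝ} {f : Pt → ℝ} (h : Van a b R f) (i : Fin 3) : Van a b R (pd i f) := by
  intro p hp
  have : f =ᶠ[𝓝 p] fun _ => 0 := by
    filter_upwards [(WW_open a b R).mem_nhds hp] with q hq using h q hq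
  rw [pd_congr i this, pd_const]

theorem Van.vv {a b R : ℝ} {f : Pt → ℝ} (h : Van a b R f) : Van a b R (vv f) := by
  intro p hp
  simp [_root_.vv, h p hp, h.pd 0 p hp, h.pd 1 p hp, h.pd 2 p hp]

theorem Van.GG {a b R : ℝ} {f : Pt → ℝ} (h : Van a b R f) : Van a b R (GG f) := by
  intro p hp
  simp [_root_.GG, h.pd 0 p hp, (h.pd 0).pd 0 p hp, (h.pd 0).pd 1 p hp, (h.pd 0).pd 2 p hp,
    (h.pd 1).pd 1 p hp, (h.pd 2).pd 2 p hp]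

theorem Van.ee {a b R : ℝ} {f : Pt → ℝ} (h : Van a b R f) : Van a b R (ee f) := by
  intro p hp
  simp [_root_.ee, h.vv p hp, h.pd 1 p hp, h.pd 2 p hp]

theorem Van.VV {a b R : ℝ} {f : Pt → ℝ} (h : Van a b R f) (i : Fin 3) : Van a b R (VV i f) := by
  intro p hp
  simp [_root_.VV, h.vv p hp, h.pd 1 p hp, h.pd 2 p hp]

theorem mk_smooth : ContDiff ℝ ∞ (fun q : ℝ × (Fin 2 → ℝ) => mk q.1 q.2) := by
  rw [contDiff_pi]
  intro j
  fin_cases j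
  · exact contDiff_fst
  · exact (contDiff_apply ℝ ℝ (0 : Fin 2)).comp contDiff_snd
  · exact (contDiff_apply ℝ ℝ (1 : Fin 2)).comp contDiff_snd

theorem mk_mem {a b R s : ℝ} (hs : a < s ∧ s < b) (hR : 0 ≤ R) {x : Fin 2 → ℝ} (hx : x ∉ KK R) :
    mk s x ∈ WW a b R := by
  refine ⟨hs, ?_⟩
  by_contra! hc
  apply hx
  simp only [KK, mem_closedBall_zero_iff, pi_norm_le_iff_of_nonneg hR]
  intro j
  fin_cases j
  · exact hc.1
  · exact hc.2

theorem Van.zero {a b R : ℝ} {f : Pt → ℝ} (h : Van a b R f) (hf : Continuous f) (hab : a < b)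
    (hR : 0 ≤ R) {s : ℝ} (hs : s ∈ Set.Icc a b) {x : Fin 2 → ℝ} (hx : x ∉ KK R) :
    f (mk s x) = 0 := by
  have hc : IsClosed {s : ℝ | f (mk s x) = 0} := by
    apply isClosed_eq _ continuous_const
    have : Continuous (fun s : ℝ => mk s x) :=
      mk_smooth.continuous.comp (f := fun s : ℝ => (s, x)) (by fun_prop)
    exact hf.comp this
  have h1 : Set.Ioo a b ⊆ {s : ℝ | f (mk s x) = 0} := fun s hs => h _ (mk_mem hs hR hx)
  have h2 := closure_minimal h1 hc
  rw [closure_Ioo hab.ne] at h2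
  exact h2 hs

theorem Van.int {a b R : ℝ} {f : Pt → ℝ} (h : Van a b R f) (hf : Continuous f) (hab : a < b)
    (hR : 0 ≤ R) {s : ℝ} (hs : s ∈ Set.Icc a b) :
    ∫ x, f (mk s x) = ∫ x in KK R, f (mk s x) :=
  (setIntegral_eq_integral_of_forall_compl_eq_zero fun _ hx => h.zero hf hab hR hs hx).symm

theorem KK_compact (R : ℝ) : IsCompact (KK R) := isCompact_closedBall 0 R

theorem cont_mk {f : Pt → ℝ} (hf : Continuous f) (s : ℝ) : Continuous (fun x => f (mk s x)) :=
  hf.comp (mk_smooth.continuous.comp (f := fun x => (s, x)) (by fun_prop))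

theorem int_mk {f : Pt → ℝ} (hf : Continuous f) (R s : ℝ) :
    IntegrableOn (fun x => f (mk s x)) (KK R) :=
  (cont_mk hf s).continuousOn.integrableOn_compact (KK_compact R)

theorem cont_int {f : Pt → ℝ} (hf : Continuous f) (R : ℝ) :
    Continuous (fun s => ∫ x in KK R, f (mk s x)) :=
  continuous_parametric_integral_of_continuous (f := fun s x => f (mk s x))
    (hf.comp mk_smooth.continuous) (KK_compact R)

theorem deriv_mk {f : Pt → ℝ} (hf : ContDiff ℝ ∞ f) (s : ℝ) (x : Fin 2 → ℝ) :
    HasDerivAt (fun s => f (mk s x)) (pd 0 f (mk s x)) s := by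
  have h1 : HasDerivAt (fun s => mk s x) (Pi.single 0 1 : Pt) s := by
    rw [hasDerivAt_pi]
    intro j
    fin_cases j
    · simpa [mk] using hasDerivAt_id' s
    · simpa [mk] using hasDerivAt_const s (x 0)
    · simpa [mk] using hasDerivAt_const s (x 1)
  exact (sm_diff hf (mk s x)).hasFDerivAt.comp_hasDerivAt s h1

theorem deriv_int {f : Pt → ℝ} (hf : ContDiff ℝ ∞ f) (R s : ℝ) :
    HasDerivAt (fun s => ∫ x in KK R, f (mk s x)) (∫ x in KK R, pd 0 f (mk s x)) s := by
  have hc := (pd_smooth 0 hf).continuous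
  have hc2 : Continuous (fun q : ℝ × (Fin 2 → ℝ) => pd 0 f (mk q.1 q.2)) :=
    hc.comp mk_smooth.continuous
  obtain ⟨M, hM⟩ := ((isCompact_Icc (a := s - 1) (b := s + 1)).prod (KK_compact R)).bddAbove_image
    hc2.norm.continuousOn
  refine (hasDerivAt_integral_of_dominated_loc_of_deriv_le (𝕜 := ℝ) (E := ℝ)
    (F := fun s x => f (mk s x)) (F' := fun s x => pd 0 f (mk s x)) (s := Set.Icc (s - 1) (s + 1))
    (bound := fun _ => M) (Icc_mem_nhds (by linarith) (by linarith)) ?_ ?_ ?_ ?_ ?_ ?_).2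
  · exact Filter.Eventually.of_forall fun s => (int_mk hf.continuous R s).aestronglyMeasurable
  · exact int_mk hf.continuous R s
  · exact (int_mk hc R s).aestronglyMeasurable
  · filter_upwards [ae_restrict_mem (KK_compact R).measurableSet] with x hx t ht
    exact hM ⟨(t, x), ⟨ht, hx⟩, rfl⟩
  · exact integrableOn_const (KK_compact R).measure_lt_top.ne
  · exact Filter.Eventually.of_forall fun x t _ => deriv_mk hf t x

theorem div_int {a b R : ℝ} {f : Pt → ℝ} (h : Van a b R f) (hf : ContDiff ℝ ∞ f)
    (hR : 0 ≤ R) {s : ℝ} (hs : s ∈ Set.Ioo a b) (i : Fin 2) :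
    ∫ x, pd i.succ f (mk s x) = 0 := by
  set g : (Fin 2 → ℝ) → ℝ := fun x => f (mk s x) with hg
  have hab : a < b := hs.1.trans hs.2
  have hgs : ContDiff ℝ ∞ g :=
    hf.comp (mk_smooth.comp (f := fun x => (s, x)) (contDiff_const.prodMk contDiff_id))
  have hgc : HasCompactSupport g :=
    HasCompactSupport.intro (KK_compact R)
      fun x hx => h.zero hf.continuous hab hR ⟨hs.1.le, hs.2.le⟩ hx
  obtain ⟨D, hD⟩ := ContDiff.lipschitzWith_of_hasCompactSupport hgc hgs (by simp)
  have key := LipschitzWith.integral_lineDeriv_mul_eq (μ := volume) (C := 0) (f := fun _ => (1 : ℝ))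
    (LipschitzWith.const 1) hD hgc (-(Pi.single i 1))
  simp only [neg_neg, mul_one] at key
  have h0 : ∀ x v, lineDeriv ℝ (fun _ : Fin 2 → ℝ => (1 : ℝ)) x v = 0 := by
    intro x v; simp [lineDeriv]
  simp only [h0, zero_mul, integral_zero] at key
  rw [key]
  congr 1
  funext x
  have hgd : DifferentiableAt ℝ g x := (hgs.differentiable (by simp)).differentiableAt
  rw [hgd.lineDeriv_eq_fderiv]
  have h1 : HasDerivAt (fun t : ℝ => mk s (x + t • Pi.single i 1)) (Pi.single i.succ 1 : Pt) 0 := by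
    rw [hasDerivAt_pi]
    intro j
    have ha : ∀ c d : ℝ, HasDerivAt (fun t : ℝ => c + t * d) d 0 := by
      intro c d
      simpa using ((hasDerivAt_id (0 : ℝ)).mul_const d).const_add c
    fin_cases j
    · have : (Pi.single i.succ 1 : Pt) 0 = 0 := by
        simp
      simpa [mk, this] using hasDerivAt_const (0 : ℝ) s
    · have : (Pi.single i.succ 1 : Pt) 1 = (Pi.single i 1 : Fin 2 → ℝ) 0 := by
        fin_cases i <;> simp [Pi.single_apply]
      simpa [mk, this] using ha (x 0) ((Pi.single i 1 : Fin 2 → ℝ) 0)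
    · have : (Pi.single i.succ 1 : Pt) 2 = (Pi.single i 1 : Fin 2 → ℝ) 1 := by
        fin_cases i <;> simp [Pi.single_apply]
      simpa [mk, this] using ha (x 1) ((Pi.single i 1 : Fin 2 → ℝ) 1)
  have e0 : mk s (x + (0 : ℝ) • Pi.single i 1) = mk s x := by simp
  have h2 : HasDerivAt (fun t : ℝ => f (mk s (x + t • Pi.single i 1)))
      (pd i.succ f (mk s x)) 0 := by
    have := (sm_diff hf (mk s (x + (0 : ℝ) • Pi.single i 1))).hasFDerivAt.comp_hasDerivAt 0 h1
    rw [e0] at this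
    exact this
  have h3 : HasLineDerivAt ℝ g (fderiv ℝ g x (Pi.single i 1)) x (Pi.single i 1) :=
    hgd.hasFDerivAt.hasLineDerivAt _
  exact h2.unique h3

theorem cauchy_schwarz {f g : Pt → ℝ} (hf : Continuous f) (hg : Continuous g) (R s : ℝ) :
    ∫ x in KK R, f (mk s x) * g (mk s x) ≤
      √(∫ x in KK R, f (mk s x) ^ 2) * √(∫ x in KK R, g (mk s x) ^ 2) := by
  have i1 := int_mk (f := fun p => f p ^ 2) (by fun_prop) R s
  have i2 := int_mk (f := fun p => g p ^ 2) (by fun_prop) R s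
  have i3 := int_mk (f := fun p => f p * g p) (by fun_prop) R s
  have hd : discrim (∫ x in KK R, f (mk s x) ^ 2) (2 * ∫ x in KK R, f (mk s x) * g (mk s x))
      (∫ x in KK R, g (mk s x) ^ 2) ≤ 0 := by
    apply discrim_le_zero
    intro t
    have : 0 ≤ ∫ x in KK R, (t * f (mk s x) + g (mk s x)) ^ 2 :=
      integral_nonneg fun x => sq_nonneg _
    have e : ∫ x in KK R, (t * f (mk s x) + g (mk s x)) ^ 2 =
        ∫ x in KK R, ((t * t) * f (mk s x) ^ 2 + (2 * t) * (f (mk s x) * g (mk s x)))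
          + g (mk s x) ^ 2 := by
      congr 1; funext x; ring
    have i4 : IntegrableOn (fun x => (t * t) * f (mk s x) ^ 2
        + (2 * t) * (f (mk s x) * g (mk s x))) (KK R) := (i1.const_mul _).add (i3.const_mul _)
    rw [e, integral_add i4 i2,
      integral_add (i1.const_mul _) (i3.const_mul _), integral_const_mul, integral_const_mul] at this
    linarith
  rw [discrim] at hd
  have hA : 0 ≤ ∫ x in KK R, f (mk s x) ^ 2 := integral_nonneg fun x => sq_nonneg _
  rw [← Real.sqrt_mul hA]
  apply Real.le_sqrt_of_sq_le
  linarith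

theorem gronwall {E N E' : ℝ → ℝ} {a b : ℝ} (hE : Continuous E) (hN : Continuous N)
    (hE0 : ∀ s, 0 ≤ E s) (hN0 : ∀ s, 0 ≤ N s)
    (hd : ∀ s ∈ Set.Ioo a b, HasDerivAt E (E' s) s)
    (hle : ∀ s ∈ Set.Ioo a b, E' s ≤ 2 * (N s * √(E s))) :
    ∀ s ∈ Set.Icc a b, √(E s) ≤ √(E a) + ∫ τ in a..s, N τ := by
  intro s hs
  apply le_of_forall_pos_le_add
  intro η hη
  have hpos : ∀ t, 0 < E t + η ^ 2 := fun t => by have := hE0 t; positivity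
  have hdI : ∀ t, HasDerivAt (fun s => ∫ τ in a..s, N τ) (N t) t := fun t =>
    intervalIntegral.integral_hasDerivAt_right (hN.intervalIntegrable _ _)
      (hN.stronglyMeasurableAtFilter _ _) hN.continuousAt
  have hdy : ∀ t ∈ Set.Ioo a b, HasDerivAt (fun s => √(E s + η ^ 2) - ∫ τ in a..s, N τ)
      (E' t / (2 * √(E t + η ^ 2)) - N t) t := fun t ht =>
    (((hd t ht).add_const _).sqrt (hpos t).ne').sub (hdI t)
  have hanti : AntitoneOn (fun s => √(E s + η ^ 2) - ∫ τ in a..s, N τ) (Set.Icc a b) := by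
    apply antitoneOn_of_deriv_nonpos (convex_Icc a b)
    · apply Continuous.continuousOn
      have : Continuous (fun s => ∫ τ in a..s, N τ) :=
        continuous_iff_continuousAt.2 fun t => (hdI t).continuousAt
      fun_prop
    · intro t ht
      rw [interior_Icc] at ht
      exact (hdy t ht).differentiableAt.differentiableWithinAt
    · intro t ht
      rw [interior_Icc] at ht
      rw [(hdy t ht).deriv, sub_nonpos, div_le_iff₀ (by have := Real.sqrt_pos.2 (hpos t); positivity)]
      have h1 := hle t ht
      have h2 : √(E t) ≤ √(E t + η ^ 2) := Real.sqrt_le_sqrt (by nlinarith)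
      have h3 := mul_le_mul_of_nonneg_left h2 (hN0 t)
      linarith
  have := hanti ⟨le_rfl, hs.1.trans hs.2⟩ hs hs.1
  simp only [intervalIntegral.integral_same, sub_zero] at this
  have h2 : √(E s) ≤ √(E s + η ^ 2) := Real.sqrt_le_sqrt (by nlinarith)
  have h3 : √(E a + η ^ 2) ≤ √(E a) + η := by
    rw [Real.sqrt_le_left (by positivity)]
    nlinarith [Real.sq_sqrt (hE0 a), Real.sqrt_nonneg (E a)]
  linarith

theorem abstract_est {a b R : ℝ} {U : Pt → ℝ} (hU : ContDiff ℝ ∞ U) (hV : Van a b R U)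
    (hab : a < b) (hR : 0 ≤ R) : ∀ s ∈ Set.Icc a b,
    √(∫ x, ee U (mk s x)) ≤ √(∫ x, ee U (mk a x))
      + ∫ τ in a..s, √(∫ x, GG U (mk τ x) ^ 2) := by
  intro s hs
  have ce := (ee_smooth hU).continuous
  have cG := (GG_smooth hU).continuous
  have cv := (vv_smooth hU).continuous
  have cG2 : Continuous (fun p => GG U p ^ 2) := by fun_prop
  have vG2 : Van a b R (fun p => GG U p ^ 2) := fun p hp => by simp [hV.GG p hp]
  have hs' : s ∈ Set.Icc a b := hs
  rw [hV.ee.int ce hab hR hs, hV.ee.int ce hab hR (s := a) ⟨le_rfl, hab.le⟩]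
  have hI : ∫ τ in a..s, √(∫ x, GG U (mk τ x) ^ 2)
      = ∫ τ in a..s, √(∫ x in KK R, GG U (mk τ x) ^ 2) := by
    apply intervalIntegral.integral_congr
    intro τ hτ
    rw [Set.uIcc_of_le hs.1] at hτ
    beta_reduce
    rw [vG2.int cG2 hab hR ⟨hτ.1, hτ.2.trans hs.2⟩]
  rw [hI]
  have ee_nn : ∀ p, 0 ≤ ee U p := fun p => by unfold ee; positivity
  refine gronwall (E := fun s => ∫ x in KK R, ee U (mk s x))
    (N := fun s => √(∫ x in KK R, GG U (mk s x) ^ 2))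
    (E' := fun s => ∫ x in KK R, pd 0 (ee U) (mk s x)) (cont_int ce R)
    (cont_int cG2 R).sqrt (fun s => integral_nonneg fun x => ee_nn _) (fun s => Real.sqrt_nonneg _)
    (fun s _ => deriv_int (ee_smooth hU) R s) ?_ s hs
  intro t ht
  have ht' : t ∈ Set.Icc a b := ⟨ht.1.le, ht.2.le⟩
  beta_reduce
  have c1 := (pd_smooth 1 (VV_smooth 1 hU)).continuous
  have c2 := (pd_smooth 2 (VV_smooth 2 hU)).continuous
  have i1 := int_mk c1 R t
  have i2 := int_mk c2 R t
  have i3 := int_mk (f := fun p => GG U p * vv U p) (by fun_prop) R t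
  have z1 : ∫ x in KK R, pd 1 (VV 1 U) (mk t x) = 0 := by
    rw [← ((hV.VV 1).pd 1).int c1 hab hR ht']
    exact div_int (hV.VV 1) (VV_smooth 1 hU) hR ht 0
  have z2 : ∫ x in KK R, pd 2 (VV 2 U) (mk t x) = 0 := by
    rw [← ((hV.VV 2).pd 2).int c2 hab hR ht']
    exact div_int (hV.VV 2) (VV_smooth 2 hU) hR ht 1
  simp only [pd_ee hU]
  have i4 : IntegrableOn (fun x => pd 1 (VV 1 U) (mk t x) + pd 2 (VV 2 U) (mk t x)) (KK R) :=
    i1.add i2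
  rw [integral_add (i3.const_mul _) i4, integral_add i1 i2, z1, z2, integral_const_mul]
  have cs := cauchy_schwarz cG cv R t
  have hve : √(∫ x in KK R, vv U (mk t x) ^ 2) ≤ √(∫ x in KK R, ee U (mk t x)) := by
    apply Real.sqrt_le_sqrt
    apply integral_mono (int_mk (f := fun p => vv U p ^ 2) (by fun_prop) R t) (int_mk ce R t)
    intro x
    simp only [ee]
    nlinarith [sq_nonneg (mk t x 0 * pd 1 U (mk t x)), sq_nonneg (mk t x 0 * pd 2 U (mk t x))]
  have := mul_le_mul_of_nonneg_left hve (Real.sqrt_nonneg (∫ x in KK R, GG U (mk t x) ^ 2))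
  linarith

theorem hyp_eq {s : ℝ} (hs : 1 ≤ s) (x : Fin 2 → ℝ) : hyp s x = QQ (mk s x) := by
  unfold hyp QQ TT
  rw [HH_eq (p := mk s x) hs]
  simp [mk]

theorem Econ_eq {φ : Pt → ℝ} (hφ : ContDiff ℝ ∞ φ) {s : ℝ} (hs : 1 < s) :
    Econ s φ = ∫ x, ee (fun q => φ (QQ q)) (mk s x) := by
  unfold Econ
  congr 1
  funext x
  rw [hyp_eq hs.le]
  have hp : 1 < (mk s x) 0 := hs
  have es : s = (mk s x) 0 := rfl
  generalize hq : mk s x = p at hp es ⊢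
  rw [es]
  unfold ee vv Kvf ubd
  rw [pd_pull 0 hφ hp, pd_pull 1 hφ hp, pd_pull 2 hφ hp]
  have hT := (TT_pos p).ne'
  have hT2 := TT_sq hp.le
  have hr : rad (QQ p) ^ 2 = p 1 ^ 2 + p 2 ^ 2 := by
    unfold rad; rw [Real.sq_sqrt (by positivity)]; rfl
  rw [hr]
  have q0 : QQ p 0 = TT p := rfl
  have q1 : QQ p 1 = p 1 := rfl
  have q2 : QQ p 2 = p 2 := rfl
  have f0 : (Fin.succ 0 : Fin 3) = 1 := rfl
  have f1 : (Fin.succ 1 : Fin 3) = 2 := rfl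
  simp only [f0, f1, q0, q1, q2, if_true, one_ne_zero, if_false, Fin.isValue, add_zero,
    show (2 : Fin 3) ≠ 0 by decide]
  congr 2
  have : TT p + (p 1 ^ 2 + p 2 ^ 2) / TT p
      = p 0 * (p 0 / TT p) + 2 * (p 1 * (p 1 / TT p) + p 2 * (p 2 / TT p)) := by
    field_simp
    linarith
  rw [this]
  ring

theorem L2f_eq {φ : Pt → ℝ} (hφ : ContDiff ℝ ∞ φ) {s : ℝ} (hs : 1 < s) :
    s * L2f s (fun p => -(negBox φ p)) = √(∫ x, GG (fun q => φ (QQ q)) (mk s x) ^ 2) := by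
  have : ∀ x, GG (fun q => φ (QQ q)) (mk s x) ^ 2 = s ^ 2 * (-(negBox φ (hyp s x))) ^ 2 := by
    intro x
    rw [box_pull hφ (p := mk s x) hs, hyp_eq hs.le]
    have : mk s x 0 = s := rfl
    rw [this]; ring
  simp only [this]
  rw [integral_const_mul, Real.sqrt_mul (sq_nonneg s), Real.sqrt_sq (by linarith)]
  rfl

theorem van_pull {s0 s1 : ℝ} (hs0 : 1 < s0) {φ : Pt → ℝ} (h : VanishNearBdry s0 s1 φ) :
    Van s0 s1 (s1 ^ 2) (fun q => φ (QQ q)) := by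
  obtain ⟨ε, hε, h⟩ := h
  rintro p ⟨⟨h1, h2⟩, h3⟩
  have hp : 1 < p 0 := hs0.trans h1
  have hT2 := TT_sq hp.le
  have hT := TT_pos p
  have hr : rad (QQ p) ^ 2 = p 1 ^ 2 + p 2 ^ 2 := by
    unfold rad; rw [Real.sq_sqrt (by positivity)]; rfl
  have hr0 : 0 ≤ rad (QQ p) := Real.sqrt_nonneg _
  have q0 : QQ p 0 = TT p := rfl
  have hb : s1 ^ 2 ≤ rad (QQ p) := by
    rcases h3 with h3 | h3
    · refine h3.le.trans (abs_le_of_sq_le_sq (a := p 1) (by nlinarith [sq_nonneg (p 2)]) hr0)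
    · refine h3.le.trans (abs_le_of_sq_le_sq (a := p 2) (by nlinarith [sq_nonneg (p 1)]) hr0)
  apply h
  · rw [q0]; exact hT
  · rw [q0, hr]; nlinarith
  · rw [q0, hr]; nlinarith
  · rw [q0]
    by_contra! hc
    nlinarith

end Integrals

/-- **Conformal energy estimate on hyperboloids** (Proposition 4.3). For smooth `φ`
vanishing near the conical boundary of `K_{[s₀,s₁]}`, and `s₀ ≤ s ≤ s₁`:
`E_con(s,φ)^{1/2} ≤ E_con(s₀,φ)^{1/2} + 2 ∫_{s₀}^s τ ‖□φ‖_{L²_f(H_τ)} dτ`,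
where `□ = −∂_t² + ∂_1² + ∂_2²`. -/
theorem conformal_energy_estimate
    (s0 s1 : ℝ) (hs0 : 1 < s0) (hs01 : s0 ≤ s1)
    (φ : Pt → ℝ) (hφ : ContDiff ℝ (⊤ : ℕ∞) φ)
    (hvan : VanishNearBdry s0 s1 φ) :
    ∀ s : ℝ, s0 ≤ s → s ≤ s1 →
      Real.sqrt (Econ s φ) ≤ Real.sqrt (Econ s0 φ)
        + 2 * ∫ τ in s0..s, τ * L2f τ (fun p => -(negBox φ p)) := by
  intro s h0s hs1
  rcases hs01.eq_or_lt with rfl | hlt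
  · obtain rfl : s = s0 := le_antisymm hs1 h0s
    simp
  have key := abstract_est (pull_smooth hφ) (van_pull hs0 hvan) hlt (sq_nonneg s1) s ⟨h0s, hs1⟩
  rw [← Econ_eq hφ (hs0.trans_le h0s), ← Econ_eq hφ hs0] at key
  have hI : ∫ τ in s0..s, τ * L2f τ (fun p => -(negBox φ p))
      = ∫ τ in s0..s, √(∫ x, GG (fun q => φ (QQ q)) (mk τ x) ^ 2) := by
    apply intervalIntegral.integral_congr
    intro τ hτ
    rw [Set.uIcc_of_le h0s] at hτ
    exact L2f_eq hφ (hs0.trans_le hτ.1)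
  have hpos : 0 ≤ ∫ τ in s0..s, √(∫ x, GG (fun q => φ (QQ q)) (mk τ x) ^ 2) :=
    intervalIntegral.integral_nonneg h0s fun τ _ => Real.sqrt_nonneg _
  rw [hI]
  linarith
end
end
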